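/- arXiv:funct-an/9712007 — 12 statements merged into one kernel-verified Lean document; each statement's English description precedes it below -/
import Mathlib

section
/- Let X be a locally compact Hausdorff space, let U and U' be open subsets of X, and let θ : U' → U be a homeomorphism. Let f : X → ℂ be a continuous function vanishing at infinity with f(x) = 0 for all x ∉ U, and let x₀ ∈ X be a point such that it is not the case that both x₀ ∈ U' and θ(x₀) = x₀. Then for every ε > 0 there exists a continuous function h : X → ℝ vanishing at infinity such that h(x₀) = 1, 0 ≤ h ≤ 1, and sup_{x ∈ U'} |h(θ(x)) · f(θ(x)) · h(x)| ≤ ε. -/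
/-- A point which is not fixed by a partial homeomorphism `θ` has a neighbourhood `W` such that
`f` is small at `θ x` whenever both `x` and `θ x` lie in `W`. -/
theorem exists_isOpen_norm_le_of_not_fixed {X E : Type*} [TopologicalSpace X] [T2Space X]
    [NormedAddCommGroup E] {U U' : Set X} (hU' : IsOpen U') (θ : U' ≃ₜ U) {f : X → E} {ε : ℝ}
    (hε : 0 < ε) (hf_van : IsCompact {x : X | ε ≤ ‖f x‖}) (hf_supp : ∀ x ∉ U, f x = 0)
    {x₀ : X} (hx₀ : ¬ ∃ hx : x₀ ∈ U', (θ ⟨x₀, hx⟩ : X) = x₀) :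
    ∃ W : Set X, IsOpen W ∧ x₀ ∈ W ∧
      ∀ x : U', (x : X) ∈ W → (θ x : X) ∈ W → ‖f (θ x)‖ ≤ ε := by
  by_cases hx : x₀ ∈ U'
  · obtain ⟨A, B, hA, hB, hxA, hxB, hAB⟩ := t2_separation fun h => hx₀ ⟨hx, Eq.symm h⟩
    refine ⟨A ∩ (fun x : U' => (x : X)) '' {x | (θ x : X) ∈ B}, hA.inter ?_,
      ⟨hxA, ⟨x₀, hx⟩, hxB, rfl⟩, ?_⟩
    · exact hU'.isOpenMap_subtype_val _ (hB.preimage (continuous_subtype_val.comp θ.continuous))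
    · rintro x ⟨-, y, hy, hyx⟩ ⟨hθ, -⟩
      obtain rfl : y = x := Subtype.ext hyx
      exact (Set.disjoint_left.mp hAB hθ hy).elim
  · have hKU : {x : X | ε ≤ ‖f x‖} ⊆ Set.range ((↑) : U → X) := by
      intro x hxK
      rw [Subtype.range_coe]
      by_contra h
      rw [Set.mem_ofPred_eq, hf_supp x h, norm_zero] at hxK
      exact hxK.not_gt hε
    have hK : IsCompact ((↑) ⁻¹' {x : X | ε ≤ ‖f x‖} : Set U) :=
      Topology.IsInducing.subtypeVal.isCompact_preimage' hf_van hKU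
    have hK' := (θ.isCompact_preimage.mpr hK).image continuous_subtype_val
    refine ⟨_, hK'.isClosed.isOpen_compl, ?_, ?_⟩
    · rintro ⟨y, -, rfl⟩
      exact hx y.2
    · intro x hxW _
      by_contra! h
      exact hxW ⟨x, h.le, rfl⟩


/-- Let `X` be a locally compact Hausdorff space, `U, U'` open subsets and
`θ : U' → U` a homeomorphism.  Let `f : X → ℂ` be continuous, vanishing at infinity
(for every `ε > 0` the set where `‖f‖ ≥ ε` is compact), with `f = 0` off `U`.  Let
`x₀ ∈ X` be such that it is not the case that both `x₀ ∈ U'` and `θ x₀ = x₀`.  Then for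
every `ε > 0` there is a continuous `h : X → ℝ` vanishing at infinity with `h x₀ = 1`,
`0 ≤ h ≤ 1`, and `‖h (θ x) * f (θ x) * h x‖ ≤ ε` for every `x ∈ U'`. -/
theorem stmt_1 {X : Type*} [TopologicalSpace X] [LocallyCompactSpace X] [T2Space X]
    (U U' : Set X) (hU : IsOpen U) (hU' : IsOpen U')
    (θ : U' ≃ₜ U)
    (f : X → ℂ) (hf_cont : Continuous f)
    (hf_van : ∀ ε : ℝ, 0 < ε → IsCompact {x : X | ε ≤ ‖f x‖})
    (hf_supp : ∀ x ∉ U, f x = 0)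
    (x₀ : X) (hx₀ : ¬ ∃ hx : x₀ ∈ U', ((θ ⟨x₀, hx⟩ : X) = x₀))
    (ε : ℝ) (hε : 0 < ε) :
    ∃ h : X → ℝ, Continuous h ∧
      (∀ δ : ℝ, 0 < δ → IsCompact {x : X | δ ≤ |h x|}) ∧
      h x₀ = 1 ∧
      (∀ x, 0 ≤ h x ∧ h x ≤ 1) ∧
      (∀ x : U', ‖(h (θ x : X) : ℂ) * f (θ x : X) * (h (x : X) : ℂ)‖ ≤ ε) := by
  obtain ⟨W, hW, hxW, hfW⟩ :=
    exists_isOpen_norm_le_of_not_fixed hU' θ hε (hf_van ε hε) hf_supp hx₀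
  obtain ⟨h, h_one, h_zero, h_supp, h_mem⟩ :=
    exists_continuous_one_zero_of_isCompact (isCompact_singleton (x := x₀)) hW.isClosed_compl
      (Set.disjoint_singleton_left.mpr fun hx => hx hxW)
  refine ⟨h, h.continuous, fun δ hδ => ?_, h_one rfl, h_mem, fun x => ?_⟩
  · refine h_supp.isCompact.of_isClosed_subset
      (isClosed_le continuous_const h.continuous.abs) fun x hx => subset_tsupport _ fun h0 => ?_
    rw [Set.mem_ofPred_eq, h0, abs_zero] at hx
    exact hx.not_gt hδ
  · by_cases hx : (x : X) ∈ W
    · by_cases hθ : (θ x : X) ∈ W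
      · have h_norm (y : X) : ‖(h y : ℂ)‖ ≤ 1 := by
          rw [Complex.norm_real, Real.norm_of_nonneg (h_mem y).1]
          exact (h_mem y).2
        rw [norm_mul, norm_mul]
        calc ‖(h (θ x) : ℂ)‖ * ‖f (θ x)‖ * ‖(h x : ℂ)‖ ≤ 1 * ε * 1 := by
              gcongr
              exacts [h_norm _, hfW x hx hθ, h_norm _]
          _ = ε := by ring
      · have h0 : h (θ x) = 0 := h_zero hθ
        simp [h0, hε.le]
    · have h0 : h x = 0 := h_zero hx
      simp [h0, hε.le]
end

section
/- Let (G,P) be a quasi-lattice ordered group. If ω ⊆ G is hereditary and directed with e ∈ ω, and z⁻¹ ∈ ω for some z ∈ G, then the translate zω := {zx : x ∈ ω} is hereditary and directed and contains e. -/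
/-- `(G,P)` is quasi-lattice ordered: `P` is a submonoid with `P ∩ P⁻¹ = {e}`
(ordering `x ≤ y ↔ x⁻¹y ∈ P`), and any two elements of `G` with a common upper
bound in `P` have a least common upper bound in `P`. -/
structure QuasiLatticeOrdered (G : Type*) [Group G] (P : Submonoid G) : Prop where
  eq_one_of_mem_of_inv_mem : ∀ x : G, x ∈ P → x⁻¹ ∈ P → x = 1
  exists_lub : ∀ x y : G, (∃ z, z ∈ P ∧ x⁻¹ * z ∈ P ∧ y⁻¹ * z ∈ P) →
    ∃ z, z ∈ P ∧ x⁻¹ * z ∈ P ∧ y⁻¹ * z ∈ P ∧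
      ∀ w, w ∈ P → x⁻¹ * w ∈ P → y⁻¹ * w ∈ P → z⁻¹ * w ∈ P

/-- `ω ⊆ G` is hereditary: `x ∈ ω` and `p ∈ P` imply `xp⁻¹ ∈ ω`. -/
def IsHereditary {G : Type*} [Group G] (P : Submonoid G) (ω : Set G) : Prop :=
  ∀ x ∈ ω, ∀ p ∈ P, x * p⁻¹ ∈ ω

/-- `ω ⊆ G` is directed: any `x, y ∈ ω` have a common upper bound `z ∈ ω ∩ P`. -/
def IsDirectedSubset {G : Type*} [Group G] (P : Submonoid G) (ω : Set G) : Prop :=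
  ∀ x ∈ ω, ∀ y ∈ ω, ∃ z, z ∈ ω ∧ z ∈ P ∧ x⁻¹ * z ∈ P ∧ y⁻¹ * z ∈ P

/-- if `(G,P)` is quasi-lattice ordered, `ω` is hereditary and directed
with `e ∈ ω`, and `z⁻¹ ∈ ω`, then `zω = {zx : x ∈ ω}` is hereditary and directed
and contains `e`. -/
theorem stmt_4 {G : Type*} [Group G] (P : Submonoid G)
    (hQL : QuasiLatticeOrdered G P)
    (ω : Set G) (hher : IsHereditary P ω) (hdir : IsDirectedSubset P ω)
    (he : (1 : G) ∈ ω) (z : G) (hz : z⁻¹ ∈ ω) :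
    IsHereditary P ((fun x => z * x) '' ω) ∧
      IsDirectedSubset P ((fun x => z * x) '' ω) ∧
      (1 : G) ∈ (fun x => z * x) '' ω := by
  refine ⟨?_, ?_, z⁻¹, hz, mul_inv_cancel z⟩
  · rintro _ ⟨x, hx, rfl⟩ p hp
    exact ⟨x * p⁻¹, hher x hx p hp, (mul_assoc z x p⁻¹).symm⟩
  · rintro _ ⟨x, hx, rfl⟩ _ ⟨y, hy, rfl⟩
    obtain ⟨u, hu, -, hxu, hyu⟩ := hdir x hx y hy
    obtain ⟨w, hw, -, huw, hzw⟩ := hdir u hu z⁻¹ hz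
    refine ⟨z * w, ⟨w, hw, rfl⟩, by simpa using hzw, ?_, ?_⟩
    · simpa [mul_assoc] using P.mul_mem hxu huw
    · simpa [mul_assoc] using P.mul_mem hyu huw
end

section
/- Let (G,P) be a quasi-lattice ordered group and let ω ⊆ G with e ∈ ω. Then the following are equivalent: (a) for every s ∈ ω, writing η := s⁻¹ω, one has (i) t⁻¹ ∈ η for every t ∈ P, and (ii) for all x, y ∈ G: x ∈ η and y ∈ η if and only if x and y have a common upper bound in P and x ∨ y ∈ η; (b) ω is hereditary and directed. -/
/-- `z = x ∨ y`: `z` is the least common upper bound of `x` and `y` in `P`. -/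
def IsLCUB {G : Type*} [Group G] (P : Submonoid G) (x y z : G) : Prop :=
  z ∈ P ∧ x⁻¹ * z ∈ P ∧ y⁻¹ * z ∈ P ∧
    ∀ w, w ∈ P → x⁻¹ * w ∈ P → y⁻¹ * w ∈ P → z⁻¹ * w ∈ P

theorem mem_image_inv_mul_left_iff {G : Type*} [Group G] {ω : Set G} {s x : G} :
    x ∈ (fun v => s⁻¹ * v) '' ω ↔ s * x ∈ ω := by
  rw [Set.image_mul_left, inv_inv, Set.mem_preimage]

theorem IsHereditary.mem_of_le {G : Type*} [Group G] {P : Submonoid G} {ω : Set G}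
    (hω : IsHereditary P ω) {x y : G} (hy : y ∈ ω) (hxy : x⁻¹ * y ∈ P) : x ∈ ω := by
  simpa using hω y hy _ hxy

theorem Submonoid.inv_mul_mem_trans {G : Type*} [Group G] {P : Submonoid G} {x y z : G}
    (hxy : x⁻¹ * y ∈ P) (hyz : y⁻¹ * z ∈ P) : x⁻¹ * z ∈ P := by
  simpa [mul_assoc] using P.mul_mem hxy hyz

/-- for a quasi-lattice ordered `(G,P)` and `ω ⊆ G` with `e ∈ ω`, the
following are equivalent:
(a) for every `s ∈ ω`, with `η := s⁻¹ω`: (i) `t⁻¹ ∈ η` for every `t ∈ P`, and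
(ii) for all `x, y ∈ G`: `x ∈ η` and `y ∈ η` iff `x` and `y` have a common upper
bound in `P` (equivalently a least one, `x ∨ y`) with `x ∨ y ∈ η`;
(b) `ω` is hereditary and directed. -/
theorem stmt_5 {G : Type*} [Group G] (P : Submonoid G)
    (hQL : QuasiLatticeOrdered G P)
    (ω : Set G) (he : (1 : G) ∈ ω) :
    (∀ s ∈ ω,
        (∀ t ∈ P, t⁻¹ ∈ (fun v => s⁻¹ * v) '' ω) ∧
        (∀ x y : G,
          (x ∈ (fun v => s⁻¹ * v) '' ω ∧ y ∈ (fun v => s⁻¹ * v) '' ω) ↔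
            ∃ z, IsLCUB P x y z ∧ z ∈ (fun v => s⁻¹ * v) '' ω))
      ↔ (IsHereditary P ω ∧ IsDirectedSubset P ω) := by
  simp only [mem_image_inv_mul_left_iff]
  constructor
  · intro h
    refine ⟨fun x hx p hp => (h x hx).1 p hp, fun x hx y hy => ?_⟩
    obtain ⟨z, ⟨hzP, hxz, hyz, -⟩, hz⟩ :=
      ((h 1 he).2 x y).1 ⟨by rwa [one_mul], by rwa [one_mul]⟩
    exact ⟨z, by rwa [one_mul] at hz, hzP, hxz, hyz⟩
  · rintro ⟨hher, hdir⟩ s hs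
    refine ⟨hher s hs, fun x y => ⟨?_, ?_⟩⟩
    · rintro ⟨hx, hy⟩
      obtain ⟨u, hu, -, hxu, hyu⟩ := hdir _ hx _ hy
      obtain ⟨z, hz, -, huz, hsz⟩ := hdir u hu s hs
      have hxz : x⁻¹ * (s⁻¹ * z) ∈ P := by
        simpa [mul_assoc] using Submonoid.inv_mul_mem_trans hxu huz
      have hyz : y⁻¹ * (s⁻¹ * z) ∈ P := by
        simpa [mul_assoc] using Submonoid.inv_mul_mem_trans hyu huz
      obtain ⟨v, hvP, hxv, hyv, hv⟩ := hQL.exists_lub x y ⟨s⁻¹ * z, hsz, hxz, hyz⟩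
      refine ⟨v, ⟨hvP, hxv, hyv, hv⟩, hher.mem_of_le hz ?_⟩
      simpa [mul_assoc] using hv _ hsz hxz hyz
    · rintro ⟨z, ⟨-, hxz, hyz, -⟩, hz⟩
      exact ⟨hher.mem_of_le hz (by simpa [mul_assoc] using hxz),
        hher.mem_of_le hz (by simpa [mul_assoc] using hyz)⟩
end

section
/- Let (G,P) be a quasi-lattice ordered group with G discrete, and let Ω_N := {ω ⊆ G : e ∈ ω, ω is hereditary and directed}, regarded as a subspace of the product space {0,1}^G (identifying subsets of G with their characteristic functions). Then for every x ∈ G with x ≠ e, the set {ω ∈ Ω_N : x⁻¹ ∈ ω and xω = ω} has empty interior in Ω_N. -/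
/-- Hereditary, for a `Bool`-valued characteristic function `ω` of a subset of `G`. -/
def IsHereditaryB {G : Type*} [Group G] (P : Submonoid G) (ω : G → Bool) : Prop :=
  ∀ x, ω x = true → ∀ p ∈ P, ω (x * p⁻¹) = true

/-- Directed, for a `Bool`-valued characteristic function `ω` of a subset of `G`. -/
def IsDirectedB {G : Type*} [Group G] (P : Submonoid G) (ω : G → Bool) : Prop :=
  ∀ x y, ω x = true → ω y = true →
    ∃ z, ω z = true ∧ z ∈ P ∧ x⁻¹ * z ∈ P ∧ y⁻¹ * z ∈ P

/-- `Ω_N`: the hereditary directed subsets of `G` containing `e`, as a subspace of the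
product space `{0,1}^G`. -/
abbrev OmegaN {G : Type*} [Group G] (P : Submonoid G) : Type _ :=
  {ω : G → Bool // ω 1 = true ∧ IsHereditaryB P ω ∧ IsDirectedB P ω}

/-- The principal hereditary directed set `pP⁻¹ = {y : y ≤ p}` of an element `p ∈ P`. -/
noncomputable def OmegaN.principal {G : Type*} [Group G] (P : Submonoid G) (p : G)
    (hp : p ∈ P) : OmegaN P := by
  classical
  refine ⟨fun y => decide (y⁻¹ * p ∈ P), by simpa using hp, ?_, ?_⟩
  · intro y hy q hq
    simp only [decide_eq_true_eq] at hy ⊢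
    simpa [mul_assoc] using P.mul_mem hq hy
  · intro y z hy hz
    simp only [decide_eq_true_eq] at hy hz ⊢
    exact ⟨p, by simp, hp, hy, hz⟩

theorem OmegaN.principal_apply_eq_true {G : Type*} [Group G] {P : Submonoid G} {p : G}
    (hp : p ∈ P) (y : G) : (OmegaN.principal P p hp).1 y = true ↔ y⁻¹ * p ∈ P := by
  simp [OmegaN.principal]

theorem OmegaN.principal_le {G : Type*} [Group G] {P : Submonoid G} (ω : OmegaN P) {p : G}
    (hp : p ∈ P) (hω : ω.1 p = true) {y : G} (hy : (OmegaN.principal P p hp).1 y = true) :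
    ω.1 y = true := by
  rw [OmegaN.principal_apply_eq_true] at hy
  simpa using ω.2.2.1 p hω _ hy

/-- Finitely many members of a directed set have a common upper bound in it. -/
theorem OmegaN.exists_upper_bound {G : Type*} [Group G] {P : Submonoid G} (ω : OmegaN P)
    (F : Finset G) :
    ∃ p ∈ P, ω.1 p = true ∧ ∀ y ∈ F, ω.1 y = true → y⁻¹ * p ∈ P := by
  classical
  induction F using Finset.induction_on with
  | empty => exact ⟨1, P.one_mem, ω.2.1, by simp⟩
  | insert a F _ ih =>
    obtain ⟨p, hp, hωp, hF⟩ := ih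
    by_cases ha : ω.1 a = true
    · obtain ⟨z, hωz, hz, haz, hpz⟩ := ω.2.2.2 a p ha hωp
      refine ⟨z, hz, hωz, fun y hy hωy => ?_⟩
      rcases Finset.mem_insert.1 hy with rfl | hy
      · exact haz
      · simpa [mul_assoc] using P.mul_mem (hF y hy hωy) hpz
    · refine ⟨p, hp, hωp, fun y hy hωy => ?_⟩
      rcases Finset.mem_insert.1 hy with rfl | hy
      · exact absurd hωy ha
      · exact hF y hy hωy

/-- The principal sets are dense in `Ω_N`. -/
theorem OmegaN.exists_principal_mem {G : Type*} [Group G] {P : Submonoid G}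
    {U : Set (OmegaN P)} (hU : IsOpen U) {ω : OmegaN P} (hω : ω ∈ U) :
    ∃ (p : G) (hp : p ∈ P), OmegaN.principal P p hp ∈ U := by
  obtain ⟨V, hV, rfl⟩ := isOpen_induced_iff.1 hU
  obtain ⟨F, u, hu, hFV⟩ := isOpen_pi_iff.1 hV ω.1 hω
  obtain ⟨p, hp, hωp, hF⟩ := ω.exists_upper_bound F
  refine ⟨p, hp, hFV fun y hy => ?_⟩
  have h : (OmegaN.principal P p hp).1 y = ω.1 y :=
    Bool.eq_iff_iff.2 ⟨ω.principal_le hp hωp,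
      fun h => (OmegaN.principal_apply_eq_true hp y).2 (hF y hy h)⟩
  rw [h]
  exact (hu y hy).2

/-- for a quasi-lattice ordered group `(G,P)` (`G` discrete) and every
`x ≠ e`, the set `{ω ∈ Ω_N : x⁻¹ ∈ ω and xω = ω}` has empty interior in `Ω_N`.
(Here `y ∈ xω ↔ x⁻¹y ∈ ω`, so `xω = ω` reads `∀ y, ω (x⁻¹ y) = ω y`.) -/
theorem stmt_6 {G : Type*} [Group G] (P : Submonoid G)
    (hQL : QuasiLatticeOrdered G P) (x : G) (hx : x ≠ 1) :
    interior {ω : OmegaN P |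
        ω.1 x⁻¹ = true ∧ ∀ y : G, ω.1 (x⁻¹ * y) = ω.1 y} = ∅ := by
  refine Set.eq_empty_of_forall_notMem fun ω hω => ?_
  obtain ⟨p, hp, hpU⟩ := OmegaN.exists_principal_mem isOpen_interior hω
  have hinv := (interior_subset hpU).2
  have h (y : G) : (x⁻¹ * y)⁻¹ * p ∈ P ↔ y⁻¹ * p ∈ P := by
    rw [← OmegaN.principal_apply_eq_true hp, ← OmegaN.principal_apply_eq_true hp, hinv]
  have h₁ : p⁻¹ * x * p ∈ P := by simpa using (h p).2 (by simp)
  have h₂ : (p⁻¹ * x * p)⁻¹ ∈ P := by simpa [mul_assoc] using (h (x * p)).1 (by simp)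
  have h₃ := hQL.eq_one_of_mem_of_inv_mem _ h₁ h₂
  apply hx
  rwa [mul_assoc, inv_mul_eq_one, eq_comm, mul_eq_right] at h₃
end

section
/- Let (G,P) be a quasi-lattice ordered group and let V be a covariant isometric representation of P on a complex Hilbert space H. For x ∈ PP⁻¹ let σ(x) := x ∨ e (the least upper bound of x and e in P) and τ(x) := x⁻¹σ(x), which lies in P. Define u_x := V_{σ(x)} V_{τ(x)}* for x ∈ PP⁻¹ and u_x := 0 for x ∉ PP⁻¹. Then u is a partial representation of G satisfying: (N1) u_t* u_t = 1 for all t ∈ P; and (N2) u_x u_x* u_y u_y* = u_{x∨y} u_{x∨y}* for all x, y ∈ G, where the right-hand side is interpreted as 0 when x and y have no common upper bound in P. -/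
open ContinuousLinearMap

/-- A partial representation of a group `G` on a Hilbert space `H`:
`u(e) = 1`, `u(t⁻¹) = u(t)*`, and `u(s)u(t)u(t⁻¹) = u(st)u(t⁻¹)`. -/
def IsPartialRep {G : Type*} [Group G] {H : Type*} [NormedAddCommGroup H]
    [InnerProductSpace ℂ H] [CompleteSpace H] (u : G → H →L[ℂ] H) : Prop :=
  u 1 = 1 ∧ (∀ t : G, u t⁻¹ = adjoint (u t)) ∧
    ∀ s t : G, u s * u t * u t⁻¹ = u (s * t) * u t⁻¹

open Classical in
/-- The partial representation associated to an isometric representation `V` of `P`: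
`u x = V_{σ(x)} V_{τ(x)}*` if `x ∈ PP⁻¹` (i.e. `σ(x) = x ∨ e` exists, `τ(x) = x⁻¹σ(x)`),
and `u x = 0` otherwise (no common upper bound of `x` and `e` in `P`). -/
noncomputable def uRep {G : Type*} [Group G] (P : Submonoid G)
    {H : Type*} [NormedAddCommGroup H] [InnerProductSpace ℂ H] [CompleteSpace H]
    (V : G → H →L[ℂ] H) (x : G) : H →L[ℂ] H :=
  if h : ∃ s : G, IsLCUB P x 1 s then
    V h.choose * adjoint (V (x⁻¹ * h.choose))
  else 0

section GroupOrder

variable {G : Type*} [Group G] {P : Submonoid G}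

theorem IsLCUB.unique (hQL : QuasiLatticeOrdered G P) {x y z w : G}
    (hz : IsLCUB P x y z) (hw : IsLCUB P x y w) : z = w := by
  have h₁ := hz.2.2.2 w hw.1 hw.2.1 hw.2.2.1
  have h₂ := hw.2.2.2 z hz.1 hz.2.1 hz.2.2.1
  exact inv_mul_eq_one.mp (hQL.eq_one_of_mem_of_inv_mem _ h₁ (by simpa using h₂))

theorem isLCUB_one_of_mem {p : G} (hp : p ∈ P) : IsLCUB P p 1 p :=
  ⟨hp, by simp, by simpa using hp, fun _ _ h _ => h⟩

theorem IsLCUB.inv_one {x p : G} (h : IsLCUB P x 1 p) : IsLCUB P x⁻¹ 1 (x⁻¹ * p) := by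
  refine ⟨h.2.1, by simpa using h.1, by simpa using h.2.1, fun w hw hxw _ => ?_⟩
  have := h.2.2.2 (x * w) (by simpa using hxw) (by simpa using hw) (by simpa using hxw)
  simpa [mul_assoc] using this

/-- Elements of `P` above `x` are exactly the elements of `P` above `x ∨ 1`. -/
theorem IsLCUB.inv_mul_mem_iff {x p w : G} (h : IsLCUB P x 1 p) (hw : w ∈ P) :
    p⁻¹ * w ∈ P ↔ x⁻¹ * w ∈ P := by
  refine ⟨fun hpw => ?_, fun hxw => h.2.2.2 w hw hxw (by simpa using hw)⟩
  simpa [mul_assoc] using P.mul_mem h.2.1 hpw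

theorem isLCUB_congr {x x' y y' : G} (hx : ∀ w ∈ P, x⁻¹ * w ∈ P ↔ x'⁻¹ * w ∈ P)
    (hy : ∀ w ∈ P, y⁻¹ * w ∈ P ↔ y'⁻¹ * w ∈ P) {z : G} (h : IsLCUB P x y z) :
    IsLCUB P x' y' z :=
  ⟨h.1, (hx z h.1).mp h.2.1, (hy z h.1).mp h.2.2.1, fun w hw hxw hyw =>
    h.2.2.2 w hw ((hx w hw).mpr hxw) ((hy w hw).mpr hyw)⟩

/-- Left translation by `t⁻¹` of a least common upper bound of `s⁻¹` and `p`. -/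
theorem IsLCUB.inv_translate {s t p z : G} (hp : p ∈ P) (hq : t⁻¹ * p ∈ P)
    (h : IsLCUB P s⁻¹ p z) : IsLCUB P (s * t)⁻¹ (t⁻¹ * p) (t⁻¹ * z) := by
  obtain ⟨hz, hsz, hpz, hmin⟩ := h
  refine ⟨by simpa [mul_assoc] using P.mul_mem hq hpz, by simpa [mul_assoc] using hsz,
    by simpa [mul_assoc] using hpz, fun w hw hsw hqw => ?_⟩
  have hpw : p⁻¹ * (t * w) ∈ P := by simpa [mul_assoc] using hqw
  have htw : t * w ∈ P := by simpa using P.mul_mem hp hpw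
  simpa [mul_assoc] using hmin (t * w) htw (by simpa [mul_assoc] using hsw) hpw

end GroupOrder

section Representation

variable {G : Type*} [Group G] {P : Submonoid G}
  {H : Type*} [NormedAddCommGroup H] [InnerProductSpace ℂ H] [CompleteSpace H]
  {V : G → H →L[ℂ] H}

theorem uRep_eq_of_isLCUB (hQL : QuasiLatticeOrdered G P) {x p : G} (h : IsLCUB P x 1 p) :
    uRep P V x = V p * adjoint (V (x⁻¹ * p)) := by
  have hex : ∃ s : G, IsLCUB P x 1 s := ⟨p, h⟩
  rw [uRep, dif_pos hex, hex.choose_spec.unique hQL h]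

theorem uRep_eq_zero {x : G} (h : ¬ ∃ s : G, IsLCUB P x 1 s) : uRep P V x = 0 :=
  dif_neg h

theorem adjoint_mul_op (A B : H →L[ℂ] H) : adjoint (A * B) = adjoint B * adjoint A :=
  adjoint_comp A B

theorem map_one_of_isometric (hiso : ∀ p ∈ P, adjoint (V p) * V p = 1)
    (hmul : ∀ p ∈ P, ∀ q ∈ P, V p * V q = V (p * q)) : V 1 = 1 := by
  have h := hmul 1 P.one_mem 1 P.one_mem
  rw [mul_one] at h
  calc V 1 = adjoint (V 1) * V 1 * V 1 := by rw [hiso 1 P.one_mem, one_mul]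
    _ = 1 := by rw [mul_assoc, h, hiso 1 P.one_mem]

theorem uRep_of_mem (hQL : QuasiLatticeOrdered G P)
    (hiso : ∀ p ∈ P, adjoint (V p) * V p = 1)
    (hmul : ∀ p ∈ P, ∀ q ∈ P, V p * V q = V (p * q)) {p : G} (hp : p ∈ P) :
    uRep P V p = V p := by
  rw [uRep_eq_of_isLCUB hQL (isLCUB_one_of_mem hp), inv_mul_cancel]
  nth_rewrite 2 [← mul_one (V p)]
  congr 1
  simpa [map_one_of_isometric hiso hmul] using hiso 1 P.one_mem

theorem uRep_inv (hQL : QuasiLatticeOrdered G P) (x : G) :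
    uRep P V x⁻¹ = adjoint (uRep P V x) := by
  by_cases h : ∃ s : G, IsLCUB P x 1 s
  · obtain ⟨p, hp⟩ := h
    rw [uRep_eq_of_isLCUB hQL hp, uRep_eq_of_isLCUB hQL hp.inv_one, adjoint_mul_op,
      adjoint_adjoint]
    simp
  · have h' : ¬ ∃ s : G, IsLCUB P x⁻¹ 1 s := fun ⟨s, hs⟩ =>
      h ⟨_, by simpa using hs.inv_one⟩
    rw [uRep_eq_zero h, uRep_eq_zero h', map_zero]

theorem uRep_mul_adjoint (hQL : QuasiLatticeOrdered G P)
    (hiso : ∀ p ∈ P, adjoint (V p) * V p = 1) {x p : G} (h : IsLCUB P x 1 p) :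
    uRep P V x * adjoint (uRep P V x) = V p * adjoint (V p) := by
  rw [uRep_eq_of_isLCUB hQL h, adjoint_mul_op, adjoint_adjoint, mul_assoc,
    ← mul_assoc (adjoint _) (V _), hiso _ h.2.1, one_mul]

theorem adjoint_mul_eq_cov (hiso : ∀ p ∈ P, adjoint (V p) * V p = 1) {p q : G}
    (hp : p ∈ P) (hq : q ∈ P) :
    adjoint (V p) * V q =
      adjoint (V p) * (V p * adjoint (V p) * (V q * adjoint (V q))) * V q := by
  calc adjoint (V p) * V q
      = (adjoint (V p) * V p) * (adjoint (V p) * V q) * (adjoint (V q) * V q) := by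
        rw [hiso p hp, hiso q hq, one_mul, mul_one]
    _ = _ := by simp only [mul_assoc]

theorem adjoint_mul_of_isLCUB (hiso : ∀ p ∈ P, adjoint (V p) * V p = 1)
    (hmul : ∀ p ∈ P, ∀ q ∈ P, V p * V q = V (p * q)) {p q z : G}
    (hp : p ∈ P) (hq : q ∈ P) (hz : IsLCUB P p q z)
    (hcov : V p * adjoint (V p) * (V q * adjoint (V q)) = V z * adjoint (V z)) :
    adjoint (V p) * V q = V (p⁻¹ * z) * adjoint (V (q⁻¹ * z)) := by
  have h₁ : adjoint (V p) * V z = V (p⁻¹ * z) := by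
    have := hmul p hp _ hz.2.1
    rw [mul_inv_cancel_left] at this
    rw [← this, ← mul_assoc, hiso p hp, one_mul]
  have h₂ : adjoint (V z) * V q = adjoint (V (q⁻¹ * z)) := by
    have := hmul q hq _ hz.2.2.1
    rw [mul_inv_cancel_left] at this
    rw [← this, adjoint_mul_op, mul_assoc, hiso q hq, mul_one]
  rw [adjoint_mul_eq_cov hiso hp hq, hcov, ← mul_assoc, h₁, mul_assoc, h₂]

theorem uRep_mul_of_isLCUB (hQL : QuasiLatticeOrdered G P)
    (hiso : ∀ p ∈ P, adjoint (V p) * V p = 1)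
    (hmul : ∀ p ∈ P, ∀ q ∈ P, V p * V q = V (p * q))
    (hcov : ∀ p ∈ P, ∀ q ∈ P, ∀ z : G, IsLCUB P p q z →
      V p * adjoint (V p) * (V q * adjoint (V q)) = V z * adjoint (V z))
    {s p z : G} (hp : p ∈ P) (hz : IsLCUB P s⁻¹ p z) :
    uRep P V s * V p = V (s * z) * adjoint (V (p⁻¹ * z)) := by
  have hsz : s * z ∈ P := by simpa using hz.2.1
  obtain ⟨r, hr⟩ : ∃ r, IsLCUB P s 1 r :=
    hQL.exists_lub s 1 ⟨s * z, hsz, by simpa using hz.1, by simpa using hsz⟩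
  have hz' : IsLCUB P (s⁻¹ * r) p z :=
    isLCUB_congr (fun w hw => (hr.inv_one.inv_mul_mem_iff hw).symm) (fun _ _ => Iff.rfl) hz
  have hmz := hmul r hr.1 _ hz'.2.1
  rw [uRep_eq_of_isLCUB hQL hr, mul_assoc,
    adjoint_mul_of_isLCUB hiso hmul hr.2.1 hp hz' (hcov _ hr.2.1 p hp z hz'), ← mul_assoc, hmz]
  congr 2
  simp [mul_assoc]

theorem uRep_mul_eq_zero (hQL : QuasiLatticeOrdered G P)
    (hiso : ∀ p ∈ P, adjoint (V p) * V p = 1)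
    (hcov : ∀ p ∈ P, ∀ q ∈ P, (¬ ∃ z, z ∈ P ∧ p⁻¹ * z ∈ P ∧ q⁻¹ * z ∈ P) →
      V p * adjoint (V p) * (V q * adjoint (V q)) = 0)
    {s p : G} (hp : p ∈ P) (hz : ¬ ∃ z, IsLCUB P s⁻¹ p z) :
    uRep P V s * V p = 0 := by
  by_cases h : ∃ r, IsLCUB P s 1 r
  · obtain ⟨r, hr⟩ := h
    have hno : ¬ ∃ z, z ∈ P ∧ (s⁻¹ * r)⁻¹ * z ∈ P ∧ p⁻¹ * z ∈ P := fun ⟨z, h₁, h₂, h₃⟩ =>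
      hz (hQL.exists_lub _ _ ⟨z, h₁, (hr.inv_one.inv_mul_mem_iff h₁).mp h₂, h₃⟩)
    rw [uRep_eq_of_isLCUB hQL hr, mul_assoc, adjoint_mul_eq_cov hiso hr.2.1 hp,
      hcov _ hr.2.1 p hp hno]
    simp
  · rw [uRep_eq_zero h, zero_mul]

end Representation

/-- let `(G,P)` be quasi-lattice ordered and `V` a covariant isometric
representation of `P` on a complex Hilbert space `H`.  Then `u := uRep P V` is a
partial representation of `G` satisfying
(N1) `u_t* u_t = 1` for `t ∈ P`, and
(N2) `u_x u_x* u_y u_y* = u_{x∨y} u_{x∨y}*` for all `x, y ∈ G` (the right-hand side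
being `0` when `x` and `y` have no common upper bound in `P`). -/
theorem stmt_8 {G : Type*} [Group G] (P : Submonoid G)
    (hQL : QuasiLatticeOrdered G P)
    {H : Type*} [NormedAddCommGroup H] [InnerProductSpace ℂ H] [CompleteSpace H]
    (V : G → H →L[ℂ] H)
    (hiso : ∀ p ∈ P, adjoint (V p) * V p = 1)
    (hmul : ∀ p ∈ P, ∀ q ∈ P, V p * V q = V (p * q))
    (hcov : ∀ p ∈ P, ∀ q ∈ P,
      (∀ z : G, IsLCUB P p q z →
        V p * adjoint (V p) * (V q * adjoint (V q)) = V z * adjoint (V z)) ∧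
      ((¬ ∃ z, z ∈ P ∧ p⁻¹ * z ∈ P ∧ q⁻¹ * z ∈ P) →
        V p * adjoint (V p) * (V q * adjoint (V q)) = 0)) :
    IsPartialRep (uRep P V) ∧
    (∀ t ∈ P, adjoint (uRep P V t) * uRep P V t = 1) ∧
    (∀ x y : G,
      (∀ z : G, IsLCUB P x y z →
        uRep P V x * adjoint (uRep P V x) * (uRep P V y * adjoint (uRep P V y)) =
          uRep P V z * adjoint (uRep P V z)) ∧
      ((¬ ∃ z, z ∈ P ∧ x⁻¹ * z ∈ P ∧ y⁻¹ * z ∈ P) →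
        uRep P V x * adjoint (uRep P V x) * (uRep P V y * adjoint (uRep P V y)) = 0)) := by
  have hcov₁ := fun p hp q hq => (hcov p hp q hq).1
  have hcov₂ := fun p hp q hq => (hcov p hp q hq).2
  refine ⟨⟨?_, uRep_inv hQL, fun s t => ?_⟩, fun t ht => ?_,
    fun x y => ⟨fun z hz => ?_, fun h => ?_⟩⟩
  · rw [uRep_of_mem hQL hiso hmul P.one_mem, map_one_of_isometric hiso hmul]
  · by_cases ht : ∃ p, IsLCUB P t 1 p
    · obtain ⟨p, hp⟩ := ht
      have hq := hp.2.1
      suffices h : uRep P V s * V p = uRep P V (s * t) * V (t⁻¹ * p) by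
        rw [uRep_inv hQL, mul_assoc, uRep_mul_adjoint hQL hiso hp, uRep_eq_of_isLCUB hQL hp,
          adjoint_mul_op, adjoint_adjoint, ← mul_assoc, ← mul_assoc, h]
      by_cases hz : ∃ z, IsLCUB P s⁻¹ p z
      · obtain ⟨z, hz⟩ := hz
        rw [uRep_mul_of_isLCUB hQL hiso hmul hcov₁ hp.1 hz,
          uRep_mul_of_isLCUB hQL hiso hmul hcov₁ hq (hz.inv_translate hp.1 hq)]
        simp [mul_assoc]
      · have hz' : ¬ ∃ z, IsLCUB P (s * t)⁻¹ (t⁻¹ * p) z := fun ⟨z, h⟩ =>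
          hz ⟨t * z, by simpa using h.inv_translate (t := t⁻¹) hq (by simpa using hp.1)⟩
        rw [uRep_mul_eq_zero hQL hiso hcov₂ hp.1 hz, uRep_mul_eq_zero hQL hiso hcov₂ hq hz']
    · rw [uRep_inv hQL, uRep_eq_zero ht]
      simp
  · rw [uRep_of_mem hQL hiso hmul ht, hiso t ht]
  · obtain ⟨p, hp⟩ : ∃ p, IsLCUB P x 1 p :=
      hQL.exists_lub x 1 ⟨z, hz.1, hz.2.1, by simpa using hz.1⟩
    obtain ⟨q, hq⟩ : ∃ q, IsLCUB P y 1 q :=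
      hQL.exists_lub y 1 ⟨z, hz.1, hz.2.2.1, by simpa using hz.1⟩
    rw [uRep_mul_adjoint hQL hiso hp, uRep_mul_adjoint hQL hiso hq,
      uRep_of_mem hQL hiso hmul hz.1]
    exact hcov₁ p hp.1 q hq.1 z (isLCUB_congr (fun w hw => (hp.inv_mul_mem_iff hw).symm)
      (fun w hw => (hq.inv_mul_mem_iff hw).symm) hz)
  · by_cases hx : ∃ p, IsLCUB P x 1 p
    · by_cases hy : ∃ q, IsLCUB P y 1 q
      · obtain ⟨p, hp⟩ := hx
        obtain ⟨q, hq⟩ := hy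
        rw [uRep_mul_adjoint hQL hiso hp, uRep_mul_adjoint hQL hiso hq]
        exact hcov₂ p hp.1 q hq.1 fun ⟨z, h₁, h₂, h₃⟩ =>
          h ⟨z, h₁, (hp.inv_mul_mem_iff h₁).mp h₂, (hq.inv_mul_mem_iff h₁).mp h₃⟩
      · simp [uRep_eq_zero hy]
    · simp [uRep_eq_zero hx]
end

section
/- Let (G,P) be a quasi-lattice ordered group and let u be a partial representation of G on a complex Hilbert space H satisfying: (N1) u_t* u_t = 1 for all t ∈ P; and (N2) u_x u_x* u_y u_y* = u_{x∨y} u_{x∨y}* for all x, y ∈ G, where the right-hand side is interpreted as 0 when x and y have no common upper bound in P. Then the restriction V of u to P is a covariant isometric representation of P, u_x = 0 for every x ∉ PP⁻¹, and u_x = V_{σ(x)} V_{τ(x)}* for every x ∈ PP⁻¹, where σ(x) := x ∨ e and τ(x) := x⁻¹σ(x) ∈ P. -/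
open ContinuousLinearMap

/-- let `(G,P)` be quasi-lattice ordered and let `u` be a partial
representation of `G` on a complex Hilbert space `H` satisfying
(N1) `u_t* u_t = 1` for `t ∈ P`, and
(N2) `u_x u_x* u_y u_y* = u_{x∨y} u_{x∨y}*` (interpreted as `0` when `x, y` have no
common upper bound in `P`).
Then the restriction `V` of `u` to `P` is a covariant isometric representation of `P`
(it is multiplicative on `P`; isometry and covariance are instances of (N1), (N2)),
`u_x = 0` for `x ∉ PP⁻¹`, and `u_x = V_{σ(x)} V_{τ(x)}*` for `x ∈ PP⁻¹`, where
`σ(x) = x ∨ e` and `τ(x) = x⁻¹σ(x) ∈ P`. -/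
theorem stmt_9 {G : Type*} [Group G] (P : Submonoid G)
    (hQL : QuasiLatticeOrdered G P)
    {H : Type*} [NormedAddCommGroup H] [InnerProductSpace ℂ H] [CompleteSpace H]
    (u : G → H →L[ℂ] H)
    (hrep : IsPartialRep u)
    (hN1 : ∀ t ∈ P, adjoint (u t) * u t = 1)
    (hN2 : ∀ x y : G,
      (∀ z : G, IsLCUB P x y z →
        u x * adjoint (u x) * (u y * adjoint (u y)) = u z * adjoint (u z)) ∧
      ((¬ ∃ z, z ∈ P ∧ x⁻¹ * z ∈ P ∧ y⁻¹ * z ∈ P) →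
        u x * adjoint (u x) * (u y * adjoint (u y)) = 0)) :
    (∀ p ∈ P, ∀ q ∈ P, u p * u q = u (p * q)) ∧
    (∀ x : G, (¬ ∃ p ∈ P, ∃ q ∈ P, x = p * q⁻¹) → u x = 0) ∧
    (∀ x s : G, IsLCUB P x 1 s → u x = u s * adjoint (u (x⁻¹ * s))) := by
  obtain ⟨h_one, h_inv, h_mul⟩ := hrep
  have mul_right : ∀ x : G, ∀ q ∈ P, u x * u q = u (x * q) := fun x q hq => by
    have hq' : u q⁻¹ * u q = 1 := by rw [h_inv, hN1 q hq]
    calc u x * u q = u x * u q * (u q⁻¹ * u q) := by rw [hq', mul_one]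
      _ = u x * u q * u q⁻¹ * u q := by simp only [mul_assoc]
      _ = u (x * q) * u q⁻¹ * u q := by rw [h_mul]
      _ = u (x * q) := by rw [mul_assoc, hq', mul_one]
  have mul_adjoint_mul : ∀ x : G, u x = u x * adjoint (u x) * u x := fun x => by
    have h := h_mul x x⁻¹
    rw [inv_inv, mul_inv_cancel, h_one, one_mul, h_inv] at h
    exact h.symm
  have range_one : u 1 * adjoint (u 1) = 1 := by rw [← h_inv, inv_one, h_one, one_mul]
  refine ⟨fun p _ q hq => mul_right p q hq, fun x hx => ?_, fun x s hs => ?_⟩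
  · have h := (hN2 x 1).2 fun ⟨z, hz, hxz, _⟩ => hx ⟨z, hz, x⁻¹ * z, hxz, by group⟩
    rw [range_one, mul_one] at h
    rw [mul_adjoint_mul x, h, zero_mul]
  · have h := (hN2 x 1).1 s hs
    rw [range_one, mul_one] at h
    have h_adj : adjoint (u s) * u x = adjoint (u (x⁻¹ * s)) := by
      rw [← mul_right x⁻¹ s hs.1, ← star_eq_adjoint, ← star_eq_adjoint, star_mul, h_inv,
        ← star_eq_adjoint, star_star]
    rw [mul_adjoint_mul x, h, mul_assoc, h_adj]
end

section
/- Let s_1,…,s_n be a Cuntz–Krieger A-family on a complex Hilbert space H. Then there exists a unique semisaturated partial representation u of the free group 𝔽_n on H with u(g_i) = s_i for each i. Moreover, its range projections e(t) := u(t)u(t)* satisfy: e(tr)e(t) = e(tr) whenever |tr| = |t| + |r|; Σ_{j=1}^n e(g_j) = 1; and Σ_{j=1}^n a_{ij} e(g_j) = e(g_i⁻¹) for each i = 1,…,n. -/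
open ContinuousLinearMap

/-- A partial representation `u` of the free group `𝔽_n` is semisaturated if
`u(tr) = u(t)u(r)` whenever `|tr| = |t| + |r|` (lengths of reduced words). -/
def IsSemisaturated {n : ℕ} {H : Type*} [NormedAddCommGroup H]
    [InnerProductSpace ℂ H] [CompleteSpace H]
    (u : FreeGroup (Fin n) → H →L[ℂ] H) : Prop :=
  ∀ t r : FreeGroup (Fin n),
    FreeGroup.norm (t * r) = FreeGroup.norm t + FreeGroup.norm r →
      u (t * r) = u t * u r

section WordEvaluation

variable {ι R : Type*} [Ring R] [StarRing R]

/-- The generator `s i` for the letter `gᵢ`, and `star (s i)` for the letter `gᵢ⁻¹`. -/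
def signedGen (s : ι → R) (x : ι × Bool) : R := if x.2 then s x.1 else star (s x.1)

/-- The value of a word in the generators `s i` and their adjoints. -/
def wordEval (s : ι → R) (w : List (ι × Bool)) : R := (w.map (signedGen s)).prod

theorem signedGen_true (s : ι → R) (i : ι) : signedGen s (i, true) = s i := rfl

theorem signedGen_false (s : ι → R) (i : ι) : signedGen s (i, false) = star (s i) := rfl

theorem signedGen_not (s : ι → R) (i : ι) (b : Bool) :
    signedGen s (i, !b) = star (signedGen s (i, b)) := by
  cases b <;> simp [signedGen]

theorem wordEval_nil (s : ι → R) : wordEval s [] = 1 := rfl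

theorem wordEval_cons (s : ι → R) (x : ι × Bool) (w : List (ι × Bool)) :
    wordEval s (x :: w) = signedGen s x * wordEval s w := by
  simp [wordEval]

theorem wordEval_append (s : ι → R) (v w : List (ι × Bool)) :
    wordEval s (v ++ w) = wordEval s v * wordEval s w := by
  simp [wordEval]

theorem wordEval_invRev (s : ι → R) (w : List (ι × Bool)) :
    wordEval s (FreeGroup.invRev w) = star (wordEval s w) := by
  induction w with
  | nil => simp [wordEval]
  | cons x w ih =>
    rw [FreeGroup.invRev_cons, wordEval_append, ih, wordEval_cons, star_mul, ← signedGen_not]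
    simp [FreeGroup.invRev, wordEval]

theorem isPartialIsometry_signedGen {s : ι → R} (hpi : ∀ i, s i * star (s i) * s i = s i)
    (x : ι × Bool) : signedGen s x * star (signedGen s x) * signedGen s x = signedGen s x := by
  obtain ⟨i, _ | _⟩ := x
  · have h := congrArg star (hpi i)
    simpa [signedGen, mul_assoc] using h
  · exact hpi i

theorem commute_conj_of_mul_eq_or_zero {p t : R} (hp : star p = p) (h : p * t = t ∨ p * t = 0)
    (y : R) : Commute p (t * y * star t) := by
  rcases h with h | h
  · have h2 : star t * p = star t := by simpa [hp] using congrArg star h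
    rw [Commute, SemiconjBy, mul_assoc _ _ p, h2, ← mul_assoc, ← mul_assoc, h]
  · have h2 : star t * p = 0 := by simpa [hp] using congrArg star h
    rw [Commute, SemiconjBy, mul_assoc _ _ p, h2, ← mul_assoc, ← mul_assoc, h]
    simp

/-- The relations among partial isometries with orthogonal ranges, each of whose source
projections contains or annihilates each range, and whose source projections commute. -/
structure IsCKLike (s : ι → R) : Prop where
  isometry : ∀ i, s i * star (s i) * s i = s i
  orthogonal : ∀ i j, i ≠ j → star (s i) * s j = 0
  source_mul : ∀ i j, star (s i) * s i * s j = s j ∨ star (s i) * s i * s j = 0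
  source_commute : ∀ i j, Commute (star (s i) * s i) (star (s j) * s j)

namespace IsCKLike

variable {s : ι → R}

theorem wordEval_neg_cons (hs : IsCKLike s) (w : List (ι × Bool)) :
    ∀ k, FreeGroup.IsReduced ((k, false) :: w) →
      wordEval s ((k, false) :: w) * star (wordEval s ((k, false) :: w)) = star (s k) * s k ∨
        wordEval s ((k, false) :: w) * star (wordEval s ((k, false) :: w)) = 0 := by
  induction w with
  | nil => intro k _; left; simp [wordEval, signedGen]
  | cons y w ih =>
    obtain ⟨m, _ | _⟩ := y
    · intro k hw
      rw [FreeGroup.isReduced_cons_cons] at hw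
      have key : wordEval s ((k, false) :: (m, false) :: w) *
          star (wordEval s ((k, false) :: (m, false) :: w)) =
          star (s k) * (wordEval s ((m, false) :: w) * star (wordEval s ((m, false) :: w))) *
            s k := by
        rw [wordEval_cons s (k, false), signedGen_false, star_mul, star_star]
        simp only [mul_assoc]
      rw [key]
      rcases ih m hw.2 with h | h <;> rw [h]
      · rw [mul_assoc (star (s k))]
        rcases hs.source_mul m k with h' | h' <;> simp [h']
      · simp
    · intro k hw
      rw [FreeGroup.isReduced_cons_cons] at hw
      have hkm : k ≠ m := fun h => by simpa using hw.1 h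
      right
      rw [wordEval_cons, wordEval_cons, signedGen_false, signedGen_true, ← mul_assoc,
        hs.orthogonal k m hkm]
      simp

theorem commute_range (hs : IsCKLike s) {w : List (ι × Bool)} (hw : FreeGroup.IsReduced w)
    (x : ι × Bool) :
    Commute (signedGen s x * star (signedGen s x)) (wordEval s w * star (wordEval s w)) := by
  have hsource : ∀ k, Commute (signedGen s x * star (signedGen s x)) (star (s k) * s k) := by
    intro k
    obtain ⟨i, _ | _⟩ := x
    · simpa [signedGen] using hs.source_commute i k
    · simpa [signedGen] using
        (commute_conj_of_mul_eq_or_zero (by simp) (hs.source_mul k i) 1).symm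
  obtain _ | ⟨⟨k, _ | _⟩, w⟩ := w
  · simp [wordEval]
  · rcases hs.wordEval_neg_cons w k hw with h | h <;> rw [h]
    · exact hsource k
    · exact Commute.zero_right _
  · have h := commute_conj_of_mul_eq_or_zero
      (p := signedGen s x * star (signedGen s x)) (t := s k) (by simp) ?_
      (wordEval s w * star (wordEval s w))
    · simpa [wordEval_cons, signedGen_true, mul_assoc] using h
    · obtain ⟨i, _ | _⟩ := x
      · simpa [signedGen] using hs.source_mul i k
      · rw [signedGen_true]
        by_cases hik : i = k
        · left; rw [hik, hs.isometry]
        · right; rw [mul_assoc, hs.orthogonal i k hik, mul_zero]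

theorem wordEval_mul_range [DecidableEq ι] (hs : IsCKLike s) (v : List (ι × Bool)) :
    ∀ w, FreeGroup.IsReduced v → FreeGroup.IsReduced w →
      wordEval s v * (wordEval s w * star (wordEval s w)) =
        wordEval s (FreeGroup.reduce (v ++ w)) * star (wordEval s w) := by
  induction v using List.reverseRecOn with
  | nil => intro w _ hw; simp [hw.reduce_eq, wordEval_nil]
  | append_singleton v x ih =>
    intro w hv hw
    obtain _ | ⟨y, w⟩ := w
    · simp [hv.reduce_eq, wordEval_nil]
    by_cases hxy : x.1 = y.1 → x.2 = y.2
    · have hred : FreeGroup.IsReduced (v ++ [x] ++ y :: w) := by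
        rw [List.append_assoc]
        exact List.isChain_append_cons_cons.2 ⟨hv, hxy, hw⟩
      rw [hred.reduce_eq, wordEval_append s (v ++ [x]), mul_assoc]
    · obtain ⟨i, b⟩ := x
      obtain rfl : y = (i, !b) := by
        obtain ⟨j, c⟩ := y
        simp only [Classical.not_imp] at hxy
        obtain ⟨rfl, hbc⟩ := hxy
        cases b <;> cases c <;> simp_all
      have hstep : FreeGroup.reduce (v ++ [(i, b)] ++ (i, !b) :: w) =
          FreeGroup.reduce (v ++ w) := by
        rw [List.append_assoc]
        exact FreeGroup.reduce.Step.eq FreeGroup.Red.Step.not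
      have hv' : FreeGroup.IsReduced v := hv.infix ⟨[], [(i, b)], by simp⟩
      have hw' : FreeGroup.IsReduced w := hw.infix ⟨[(i, !b)], [], by simp⟩
      have hpi := isPartialIsometry_signedGen hs.isometry (i, b)
      have hc := (hs.commute_range hw' (i, b)).eq
      rw [hstep, wordEval_append, wordEval_cons, wordEval_cons, wordEval_nil, signedGen_not,
        mul_one, star_mul, star_star, ← mul_assoc (wordEval s (FreeGroup.reduce _)),
        ← ih w hv' hw']
      set p := signedGen s (i, b)
      set f := wordEval s w
      calc wordEval s v * p * (star p * f * (star f * p))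
          = wordEval s v * (p * star p * (f * star f)) * p := by simp only [mul_assoc]
        _ = wordEval s v * (f * star f) * (p * star p * p) := by
            rw [hc]; simp only [mul_assoc]
        _ = wordEval s v * (f * star f) * p := by rw [hpi]

end IsCKLike

end WordEvaluation

theorem FreeGroup.toWord_mul_of_norm_add {α : Type*} [DecidableEq α] {t r : FreeGroup α}
    (h : (t * r).norm = t.norm + r.norm) : (t * r).toWord = t.toWord ++ r.toWord :=
  (FreeGroup.toWord_mul_sublist t r).eq_of_length (by simpa [FreeGroup.norm] using h)

section HilbertSpace

variable {H : Type*} [NormedAddCommGroup H] [InnerProductSpace ℂ H] [CompleteSpace H]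

theorem star_mul_eq_zero_of_sum_range_eq_one {ι : Type*} [Fintype ι] {s : ι → H →L[ℂ] H}
    (hpi : ∀ i, s i * star (s i) * s i = s i) (hsum : ∑ j, s j * star (s j) = 1)
    {i j : ι} (hij : i ≠ j) : star (s i) * s j = 0 := by
  classical
  have h1 : ∑ k, star (star (s k) * s j) * (star (s k) * s j) = star (s j) * s j := by
    calc _ = star (s j) * (∑ k, s k * star (s k)) * s j := by
          rw [Finset.mul_sum, Finset.sum_mul]
          simp [mul_assoc]
      _ = _ := by rw [hsum, mul_one]
  have h2 : star (star (s j) * s j) * (star (s j) * s j) = star (s j) * s j := by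
    rw [star_mul, star_star, mul_assoc, ← mul_assoc (s j), hpi]
  rw [← Finset.add_sum_erase _ _ (Finset.mem_univ j), h2, add_eq_left,
    Finset.sum_eq_zero_iff_of_nonneg fun k _ => star_mul_self_nonneg _] at h1
  exact CStarRing.star_mul_self_eq_zero_iff _ |>.1 (h1 i (by simp [hij]))

theorem isCKLike_of_cuntzKrieger {ι : Type*} [Fintype ι] {a : ι → ι → Bool}
    {s : ι → H →L[ℂ] H} (hpi : ∀ i, s i * star (s i) * s i = s i)
    (hsum : ∑ j, s j * star (s j) = 1)
    (hsource : ∀ i, ∑ j, (if a i j = true then s j * star (s j) else 0) = star (s i) * s i) :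
    IsCKLike s := by
  classical
  have horth : ∀ i j, i ≠ j → star (s i) * s j = 0 := fun i j =>
    star_mul_eq_zero_of_sum_range_eq_one hpi hsum
  have hmul : ∀ i j, star (s i) * s i * s j = s j ∨ star (s i) * s i * s j = 0 := by
    intro i j
    have h : star (s i) * s i * s j = if a i j = true then s j else 0 := by
      rw [← hsource, Finset.sum_mul, Finset.sum_eq_single j]
      · split_ifs <;> simp [hpi]
      · intro k _ hk
        split_ifs <;> simp [mul_assoc, horth k j hk]
      · simp
    rw [h]
    split_ifs <;> simp
  refine ⟨hpi, horth, hmul, fun i j => ?_⟩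
  rw [← hsource j]
  refine Commute.sum_right _ _ _ fun k _ => ?_
  split_ifs
  · simpa using commute_conj_of_mul_eq_or_zero (by simp) (hmul i k) 1
  · exact Commute.zero_right _

theorem eq_wordEval_of_isPartialRep {n : ℕ} {s : Fin n → H →L[ℂ] H}
    {u : FreeGroup (Fin n) → H →L[ℂ] H} (hu : IsPartialRep u) (hss : IsSemisaturated u)
    (hgen : ∀ i, u (FreeGroup.of i) = s i) (t : FreeGroup (Fin n)) :
    u t = wordEval s t.toWord := by
  suffices h : ∀ w, FreeGroup.IsReduced w → u (FreeGroup.mk w) = wordEval s w by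
    simpa only [FreeGroup.mk_toWord] using h t.toWord FreeGroup.isReduced_toWord
  intro w
  induction w with
  | nil => intro _; exact hu.1
  | cons x w ih =>
    intro hw
    have hw' : FreeGroup.IsReduced w := hw.infix ⟨[x], [], by simp⟩
    have hmul : FreeGroup.mk (x :: w) = FreeGroup.mk [x] * FreeGroup.mk w := by simp
    have hx : u (FreeGroup.mk [x]) = signedGen s x := by
      obtain ⟨i, _ | _⟩ := x
      · rw [signedGen_false, ContinuousLinearMap.star_eq_adjoint, ← hgen, ← hu.2.1]
        rfl
      · exact hgen i
    rw [hmul, hss, hx, ih hw', wordEval_cons]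
    rw [← hmul]
    simp only [FreeGroup.norm, FreeGroup.toWord_mk, hw.reduce_eq, hw'.reduce_eq,
      FreeGroup.reduce_singleton]
    simp [add_comm]

theorem IsPartialRep.range_mul_range {n : ℕ} {u : FreeGroup (Fin n) → H →L[ℂ] H}
    (hu : IsPartialRep u) (hss : IsSemisaturated u) {t r : FreeGroup (Fin n)}
    (h : FreeGroup.norm (t * r) = FreeGroup.norm t + FreeGroup.norm r) :
    (u (t * r) * adjoint (u (t * r))) * (u t * adjoint (u t)) =
      u (t * r) * adjoint (u (t * r)) := by
  have key : adjoint (u t) * u t * adjoint (u t) = adjoint (u t) := by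
    simpa [hu.1, hu.2.1] using hu.2.2 t⁻¹ t
  simp only [← ContinuousLinearMap.star_eq_adjoint] at key ⊢
  rw [hss t r h, star_mul]
  calc _ = u t * u r * (star (u r) * (star (u t) * u t * star (u t))) := by
        simp only [mul_assoc]
    _ = _ := by rw [key]

end HilbertSpace

/-- let `A = [a i j]` be an `n × n` `{0,1}`-matrix (`n ≥ 1`) with no zero
rows and `s_1, …, s_n` a Cuntz–Krieger `A`-family on a complex Hilbert space `H`.  Then
there is a unique semisaturated partial representation `u` of `𝔽_n` on `H` with
`u(g_i) = s_i`; moreover its range projections `e(t) = u(t)u(t)*` satisfy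
`e(tr)e(t) = e(tr)` whenever `|tr| = |t| + |r|`, `∑_j e(g_j) = 1`, and
`∑_j a_{ij} e(g_j) = e(g_i⁻¹)` for each `i`. -/
theorem stmt_10 {H : Type*} [NormedAddCommGroup H] [InnerProductSpace ℂ H]
    [CompleteSpace H]
    (n : ℕ) (hn : 1 ≤ n) (a : Fin n → Fin n → Bool)
    (hA : ∀ i, ∃ j, a i j = true)
    (s : Fin n → H →L[ℂ] H)
    (hpi : ∀ i, s i * adjoint (s i) * s i = s i)
    (hck1 : ∑ j, s j * adjoint (s j) = 1)
    (hckA : ∀ i, ∑ j, (if a i j = true then s j * adjoint (s j) else 0) =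
      adjoint (s i) * s i) :
    ∃ u : FreeGroup (Fin n) → H →L[ℂ] H,
      (IsPartialRep u ∧ IsSemisaturated u ∧ ∀ i, u (FreeGroup.of i) = s i) ∧
      (∀ u' : FreeGroup (Fin n) → H →L[ℂ] H,
        (IsPartialRep u' ∧ IsSemisaturated u' ∧ ∀ i, u' (FreeGroup.of i) = s i) →
          u' = u) ∧
      (∀ t r : FreeGroup (Fin n),
        FreeGroup.norm (t * r) = FreeGroup.norm t + FreeGroup.norm r →
          (u (t * r) * adjoint (u (t * r))) * (u t * adjoint (u t)) =
            u (t * r) * adjoint (u (t * r))) ∧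
      (∑ j, u (FreeGroup.of j) * adjoint (u (FreeGroup.of j)) = 1) ∧
      (∀ i, ∑ j, (if a i j = true then
            u (FreeGroup.of j) * adjoint (u (FreeGroup.of j)) else 0) =
          u (FreeGroup.of i)⁻¹ * adjoint (u (FreeGroup.of i)⁻¹)) := by
  have hs : IsCKLike s := isCKLike_of_cuntzKrieger (a := a) hpi hck1 hckA
  let u : FreeGroup (Fin n) → H →L[ℂ] H := fun t => wordEval s t.toWord
  have hinv : ∀ t, u t⁻¹ = adjoint (u t) := fun t => by
    simp only [u, FreeGroup.toWord_inv, wordEval_invRev, ContinuousLinearMap.star_eq_adjoint]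
  have hgen : ∀ i, u (FreeGroup.of i) = s i := fun i => by
    simp [u, wordEval, signedGen]
  have hrep : IsPartialRep u := by
    refine ⟨by simp [u, wordEval], hinv, fun v t => ?_⟩
    rw [hinv, mul_assoc, ← ContinuousLinearMap.star_eq_adjoint]
    simp only [u, FreeGroup.toWord_mul]
    exact hs.wordEval_mul_range _ _ FreeGroup.isReduced_toWord FreeGroup.isReduced_toWord
  have hss : IsSemisaturated u := fun t r h => by
    simp only [u, FreeGroup.toWord_mul_of_norm_add h, wordEval_append]
  refine ⟨u, ⟨hrep, hss, hgen⟩, ?_, fun t r h => hrep.range_mul_range hss h, ?_, fun i => ?_⟩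
  · rintro u' ⟨hrep', hss', hgen'⟩
    exact funext (eq_wordEval_of_isPartialRep hrep' hss' hgen')
  · simpa only [hgen] using hck1
  · simpa only [hgen, hinv, adjoint_adjoint] using hckA i
end

section
/- A subset ω ⊆ 𝔽_n belongs to Ω_CK if and only if ω satisfies conditions (S1)–(S4). -/
open FreeGroup

namespace FreeGroup

variable {α : Type*} [DecidableEq α]

theorem norm_mul_eq_add_iff {x y : FreeGroup α} :
    norm (x * y) = norm x + norm y ↔
      ∀ u ∈ x.toWord.getLast?, ∀ v ∈ y.toWord.head?, u.1 = v.1 → u.2 = v.2 := by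
  have h : IsReduced (x.toWord ++ y.toWord) ↔
      ∀ u ∈ x.toWord.getLast?, ∀ v ∈ y.toWord.head?, u.1 = v.1 → u.2 = v.2 :=
    List.isChain_append.trans
      ⟨fun h => h.2.2, fun h => ⟨isReduced_toWord, isReduced_toWord, h⟩⟩
  rw [← h, isReduced_iff_reduce_eq, ← toWord_mul]
  constructor
  · intro hn
    exact (toWord_mul_sublist x y).eq_of_length (by simpa [norm] using hn)
  · intro he
    simp [norm, he]

theorem norm_mul_inv_eq_add_or_norm_mul_eq_add {t r : FreeGroup α}
    (h : norm (t * r) = norm t + norm r) (p : FreeGroup α) :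
    norm (p * t⁻¹) = norm p + norm t⁻¹ ∨ norm (p * r) = norm p + norm r := by
  rw [norm_mul_eq_add_iff] at h
  by_contra! hc
  obtain ⟨h₁, h₂⟩ := hc
  rw [ne_eq, norm_mul_eq_add_iff] at h₁ h₂
  push Not at h₁ h₂
  obtain ⟨u, hu, v, hv, huv, huv'⟩ := h₁
  obtain ⟨u', hu', w, hw, huw, huw'⟩ := h₂
  obtain rfl : u = u' := Option.mem_unique hu hu'
  simp only [toWord_inv, invRev, List.head?_reverse, List.getLast?_map, Option.mem_def,
    Option.map_eq_some_iff] at hv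
  obtain ⟨z, hz, rfl⟩ := hv
  have := h z hz w hw (huv.symm.trans huw)
  grind

theorem mul_mem_of_mul_mul_mem {ω : Set (FreeGroup α)}
    (hω : ∀ t r, t * r ∈ ω → norm (t * r) = norm t + norm r → t ∈ ω)
    {s t r : FreeGroup α} (hs : s ∈ ω) (hstr : s * (t * r) ∈ ω)
    (h : norm (t * r) = norm t + norm r) : s * t ∈ ω := by
  rcases norm_mul_inv_eq_add_or_norm_mul_eq_add h (s * t) with h | h
  · exact hω _ _ (by simpa using hs) h
  · exact hω _ _ (by rwa [mul_assoc]) h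

end FreeGroup

/-- fix `n ≥ 1` and an `n × n` `{0,1}`-matrix `a` with no zero rows.
A subset `ω ⊆ 𝔽_n` belongs to `Ω_CK` (i.e. `e ∈ ω` and for every `s ∈ ω` the translate
`η := s⁻¹ω` satisfies (ss), (CK1), (CKA)) if and only if `ω` satisfies (S1)–(S4). -/
theorem stmt_11 (n : ℕ) (hn : 1 ≤ n) (a : Fin n → Fin n → Bool)
    (hA : ∀ i, ∃ j, a i j = true)
    (ω : Set (FreeGroup (Fin n))) :
    -- ω ∈ Ω_CK :
    ((1 : FreeGroup (Fin n)) ∈ ω ∧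
      ∀ s ∈ ω,
        -- (ss) for η = s⁻¹ω = {x | s * x ∈ ω} :
        (∀ t r : FreeGroup (Fin n), s * (t * r) ∈ ω →
          FreeGroup.norm (t * r) = FreeGroup.norm t + FreeGroup.norm r →
            s * t ∈ ω) ∧
        -- (CK1) :
        (∃! j : Fin n, s * FreeGroup.of j ∈ ω) ∧
        -- (CKA) :
        (∀ i j : Fin n, s * FreeGroup.of j ∈ ω →
          (s * (FreeGroup.of i)⁻¹ ∈ ω ↔ a i j = true)))
    ↔
    -- (S1)–(S4) :
    ((1 : FreeGroup (Fin n)) ∈ ω ∧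
      (∀ t r : FreeGroup (Fin n), t * r ∈ ω →
        FreeGroup.norm (t * r) = FreeGroup.norm t + FreeGroup.norm r → t ∈ ω) ∧
      (∀ t ∈ ω, ∃! j : Fin n, t * FreeGroup.of j ∈ ω) ∧
      (∀ t ∈ ω, ∀ i j : Fin n, t * FreeGroup.of j ∈ ω →
        (t * (FreeGroup.of i)⁻¹ ∈ ω ↔ a i j = true))) := by
  constructor
  · rintro ⟨h1, h⟩
    exact ⟨h1, by simpa using (h 1 h1).1, fun t ht => (h t ht).2.1, fun t ht => (h t ht).2.2⟩
  · rintro ⟨h1, h2, h3, h4⟩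
    exact ⟨h1, fun s hs => ⟨fun _ _ => mul_mem_of_mul_mul_mem h2 hs, h3 s hs, h4 s hs⟩⟩
end

section
/- If ω ⊆ 𝔽_n satisfies conditions (S1)–(S4) and y ∈ ω, then y = r s⁻¹ for some nonempty admissible positive words r, s ∈ 𝔽_n^+ that have the same final letter. -/
/-- The positive word `g_{i_1} ⋯ g_{i_k} ∈ 𝔽_n` associated to a list of letters. -/
def wordToF {n : ℕ} (l : List (Fin n)) : FreeGroup (Fin n) :=
  (l.map FreeGroup.of).prod

/-- A word is admissible for the matrix `a` if consecutive letters `i, j` satisfy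
`a i j = 1`; the empty word and single letters are admissible. -/
def AdmissibleWord {n : ℕ} (a : Fin n → Fin n → Bool) (l : List (Fin n)) : Prop :=
  l.Chain' (fun i j => a i j = true)

/-- Conditions (S1)–(S4) on a subset `ω ⊆ 𝔽_n`. -/
def SCond {n : ℕ} (a : Fin n → Fin n → Bool) (ω : Set (FreeGroup (Fin n))) : Prop :=
  (1 : FreeGroup (Fin n)) ∈ ω ∧
  (∀ t r : FreeGroup (Fin n), t * r ∈ ω →
    FreeGroup.norm (t * r) = FreeGroup.norm t + FreeGroup.norm r → t ∈ ω) ∧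
  (∀ t ∈ ω, ∃! j : Fin n, t * FreeGroup.of j ∈ ω) ∧
  (∀ t ∈ ω, ∀ i j : Fin n, t * FreeGroup.of j ∈ ω →
    (t * (FreeGroup.of i)⁻¹ ∈ ω ↔ a i j = true))

theorem wordToF_nil {n : ℕ} : wordToF ([] : List (Fin n)) = 1 := rfl

theorem wordToF_cons {n : ℕ} (k : Fin n) (l : List (Fin n)) :
    wordToF (k :: l) = FreeGroup.of k * wordToF l := by
  simp [wordToF]

theorem wordToF_concat {n : ℕ} (l : List (Fin n)) (k : Fin n) :
    wordToF (l ++ [k]) = wordToF l * FreeGroup.of k := by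
  simp [wordToF]

theorem FreeGroup.IsReduced.norm_mk {α : Type*} [DecidableEq α] {L : List (α × Bool)}
    (h : FreeGroup.IsReduced L) : (FreeGroup.mk L).norm = L.length := by
  rw [FreeGroup.norm, FreeGroup.toWord_mk, h.reduce_eq]

/-- `t = α β⁻¹` for positive words `α, β` which stay admissible after appending a common letter `j`,
where `ω` contains `α g_j` and the path from `α` down to `t`. -/
def HasAdmissibleFactorization {n : ℕ} (a : Fin n → Fin n → Bool) (ω : Set (FreeGroup (Fin n)))
    (t : FreeGroup (Fin n)) : Prop :=
  ∃ (α β : List (Fin n)) (j : Fin n), t = wordToF α * (wordToF β)⁻¹ ∧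
    AdmissibleWord a (α ++ [j]) ∧ AdmissibleWord a (β ++ [j]) ∧
    wordToF α * FreeGroup.of j ∈ ω ∧ ∀ γ, γ <:+ β → wordToF α * (wordToF γ)⁻¹ ∈ ω

namespace SCond

variable {n : ℕ} {a : Fin n → Fin n → Bool} {ω : Set (FreeGroup (Fin n))} {t : FreeGroup (Fin n)}

theorem hasAdmissibleFactorization_one (hω : SCond a ω) : HasAdmissibleFactorization a ω 1 := by
  obtain ⟨h1, -, h3, -⟩ := hω
  obtain ⟨j, hj, -⟩ := h3 1 h1
  refine ⟨[], [], j, by simp [wordToF_nil], List.isChain_singleton _, List.isChain_singleton _,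
    by simpa [wordToF_nil] using hj, fun γ hγ => ?_⟩
  rw [List.suffix_nil.1 hγ]
  simpa [wordToF_nil] using h1

theorem hasAdmissibleFactorization_mul_of (hω : SCond a ω) (ht : HasAdmissibleFactorization a ω t)
    {i : Fin n} (hi : t * FreeGroup.of i ∈ ω) :
    HasAdmissibleFactorization a ω (t * FreeGroup.of i) := by
  obtain ⟨-, -, h3, h4⟩ := hω
  obtain ⟨α, β, j, rfl, hα, hβ, hj, hs⟩ := ht
  have hmem := hs β List.suffix_rfl
  cases β with
  | nil =>
    simp only [wordToF_nil, inv_one, mul_one] at hi hmem ⊢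
    obtain rfl : i = j := (h3 _ hmem).unique hi hj
    obtain ⟨k, hk, -⟩ := h3 _ hi
    have hak : a i k = true := (h4 _ hi i k hk).1 (by simpa using hmem)
    refine ⟨α ++ [i], [], k, by simp [wordToF_nil, wordToF_concat], ?_, List.isChain_singleton _,
      by rwa [wordToF_concat], fun γ hγ => ?_⟩
    · refine List.IsChain.append hα (List.isChain_singleton _) ?_
      simpa using hak
    · rw [List.suffix_nil.1 hγ]
      simpa [wordToF_nil, wordToF_concat] using hi
  | cons k β =>
    have hcancel : wordToF α * (wordToF (k :: β))⁻¹ * FreeGroup.of k =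
        wordToF α * (wordToF β)⁻¹ := by
      rw [wordToF_cons]; group
    obtain rfl : i = k := (h3 _ hmem).unique hi
      (by simpa only [hcancel] using hs β (List.suffix_cons k β))
    exact ⟨α, β, j, hcancel, hα, List.IsChain.tail hβ, hj,
      fun γ hγ => hs γ (hγ.trans (List.suffix_cons _ _))⟩

theorem hasAdmissibleFactorization_mul_of_inv (hω : SCond a ω)
    (ht : HasAdmissibleFactorization a ω t) {k : Fin n} (hk : t * (FreeGroup.of k)⁻¹ ∈ ω) :
    HasAdmissibleFactorization a ω (t * (FreeGroup.of k)⁻¹) := by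
  obtain ⟨-, -, -, h4⟩ := hω
  obtain ⟨α, β, j, rfl, hα, hβ, hj, hs⟩ := ht
  have hmem := hs β List.suffix_rfl
  have hprod : wordToF α * (wordToF β)⁻¹ * (FreeGroup.of k)⁻¹ =
      wordToF α * (wordToF (k :: β))⁻¹ := by
    rw [wordToF_cons]; group
  refine ⟨α, k :: β, j, hprod, hα, ?_, hj, fun γ hγ => ?_⟩
  · cases β with
    | nil =>
      exact List.isChain_pair.2 ((h4 _ hmem k j (by simpa [wordToF_nil] using hj)).1 hk)
    | cons l β =>
      refine List.isChain_cons_cons.2 ⟨(h4 _ hmem k l ?_).1 hk, hβ⟩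
      have := hs β (List.suffix_cons l β)
      rw [wordToF_cons]
      convert this using 1
      group
  · rcases List.suffix_cons_iff.1 hγ with rfl | hγ
    · rwa [← hprod]
    · exact hs γ hγ

theorem hasAdmissibleFactorization_mk (hω : SCond a ω) (L : List (Fin n × Bool))
    (hL : FreeGroup.IsReduced L) (hmem : FreeGroup.mk L ∈ ω) :
    HasAdmissibleFactorization a ω (FreeGroup.mk L) := by
  induction L using List.reverseRecOn with
  | nil => exact hω.hasAdmissibleFactorization_one
  | append_singleton L x ih =>
    have hL' : FreeGroup.IsReduced L := List.IsChain.left_of_append hL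
    have hx : FreeGroup.IsReduced [x] := List.isChain_singleton _
    have hmul : FreeGroup.mk (L ++ [x]) = FreeGroup.mk L * FreeGroup.mk [x] :=
      FreeGroup.mul_mk.symm
    have ht := ih hL' <| hω.2.1 _ (FreeGroup.mk [x]) (hmul ▸ hmem) <| by
      rw [← hmul, hL.norm_mk, hL'.norm_mk, hx.norm_mk, List.length_append]
    rw [hmul] at hmem ⊢
    obtain ⟨i, _ | _⟩ := x
    · exact hω.hasAdmissibleFactorization_mul_of_inv ht hmem
    · exact hω.hasAdmissibleFactorization_mul_of ht hmem

end SCond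

/-- if `ω ⊆ 𝔽_n` satisfies (S1)–(S4) and `y ∈ ω`, then `y = r s⁻¹` for
some nonempty admissible positive words `r, s` with the same final letter. -/
theorem stmt_12 (n : ℕ) (hn : 1 ≤ n) (a : Fin n → Fin n → Bool)
    (hA : ∀ i, ∃ j, a i j = true)
    (ω : Set (FreeGroup (Fin n))) (hω : SCond a ω)
    (y : FreeGroup (Fin n)) (hy : y ∈ ω) :
    ∃ r s : List (Fin n), r ≠ [] ∧ s ≠ [] ∧
      AdmissibleWord a r ∧ AdmissibleWord a s ∧
      r.getLast? = s.getLast? ∧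
      y = wordToF r * (wordToF s)⁻¹ := by
  obtain ⟨α, β, j, hαβ, hα, hβ, -, -⟩ :=
    hω.hasAdmissibleFactorization_mk y.toWord FreeGroup.isReduced_toWord
      (by rwa [FreeGroup.mk_toWord])
  refine ⟨α ++ [j], β ++ [j], by simp, by simp, hα, hβ, by simp, ?_⟩
  rw [← FreeGroup.mk_toWord (x := y), hαβ, wordToF_concat, wordToF_concat]
  group
end

section
/- A path μ ∈ P_A^∞ is an isolated point of P_A^∞ if and only if there exist a (possibly empty) admissible word x and a terminal circuit γ with the concatenation xγ admissible, such that μ = xγγγ⋯ (x followed by infinitely many repetitions of γ). -/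
/-- `γ` is a circuit: a nonempty admissible word such that `γγ` is admissible
(i.e. `a (last γ) (head γ) = 1`). -/
def IsCircuit {n : ℕ} (a : Fin n → Fin n → Bool) (γ : List (Fin n)) : Prop :=
  γ ≠ [] ∧ AdmissibleWord a (γ ++ γ)

/-- A circuit is terminal if each of its letters indexes a row of `a` having exactly
one nonzero entry. -/
def IsTerminal {n : ℕ} (a : Fin n → Fin n → Bool) (γ : List (Fin n)) : Prop :=
  ∀ i ∈ γ, ∃! j : Fin n, a i j = true

/-- Infinite path space `P_A^∞`: sequences `μ` with `a (μ j) (μ (j+1)) = 1` for all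
`j`, a (compact) subspace of the product space `{1,…,n}^ℕ`. -/
abbrev PathSpace {n : ℕ} (a : Fin n → Fin n → Bool) : Type _ :=
  {μ : ℕ → Fin n // ∀ j : ℕ, a (μ j) (μ (j + 1)) = true}

/-- `μ = xγγγ⋯`: the sequence `μ` starts with the word `x`, followed by `γ`, and is
periodic of period `|γ|` from position `|x|` on. -/
def EqWordThenCycle {n : ℕ} (μ : ℕ → Fin n) (x γ : List (Fin n)) : Prop :=
  (∀ j : ℕ, ∀ h : j < x.length, μ j = x.get ⟨j, h⟩) ∧
  (∀ j : ℕ, ∀ h : j < γ.length, μ (x.length + j) = γ.get ⟨j, h⟩) ∧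
  (∀ j : ℕ, μ (x.length + γ.length + j) = μ (x.length + j))

/-- A path all of whose letters from position `m` on have a unique successor is determined
by its first `m + 1` letters. -/
theorem path_eq_of_unique_successors {n : ℕ} {a : Fin n → Fin n → Bool} {μ ν : PathSpace a}
    {m : ℕ} (hu : ∀ j, m ≤ j → ∃! k, a (μ.1 j) k = true)
    (h : ∀ j, j ≤ m → ν.1 j = μ.1 j) : ν = μ := by
  apply Subtype.ext
  funext j
  induction j with
  | zero => exact h 0 (Nat.zero_le _)
  | succ j ih =>
    rcases Nat.lt_or_ge j m with hj | hj
    · exact h (j + 1) hj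
    · have hν := ν.2 j
      rw [ih] at hν
      exact (hu j hj).unique hν (μ.2 j)

/-- A path is isolated if and only if it is the only path with some given initial word. -/
theorem isOpen_singleton_path_iff {n : ℕ} {a : Fin n → Fin n → Bool} (μ : PathSpace a) :
    IsOpen ({μ} : Set (PathSpace a)) ↔
      ∃ N : ℕ, ∀ ν : PathSpace a, (∀ j, j ≤ N → ν.1 j = μ.1 j) → ν = μ := by
  constructor
  · intro h
    obtain ⟨U, hU, hUμ⟩ := isOpen_induced_iff.mp h
    have hμU : μ.1 ∈ U := by
      have : μ ∈ Subtype.val ⁻¹' U := by rw [hUμ]; rfl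
      exact this
    obtain ⟨I, u, hu, hIu⟩ := isOpen_pi_iff.mp hU μ.1 hμU
    refine ⟨I.sup id, fun ν hν => ?_⟩
    have hνU : ν ∈ Subtype.val ⁻¹' U := by
      refine hIu fun i hi => ?_
      rw [hν i (Finset.le_sup (f := id) hi)]
      exact (hu i hi).2
    rwa [hUμ] at hνU
  · rintro ⟨N, hN⟩
    have hset : ({μ} : Set (PathSpace a)) =
        ⋂ j ∈ Finset.range (N + 1), {ν : PathSpace a | ν.1 j = μ.1 j} := by
      ext ν
      simp only [Set.mem_singleton_iff, Set.mem_iInter, Set.mem_ofPred_eq, Finset.mem_range]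
      exact ⟨fun h j _ => by rw [h], fun h => hN ν fun j hj => h j (Nat.lt_succ_of_le hj)⟩
    rw [hset]
    refine isOpen_biInter_finset fun j _ => ?_
    have hc : Continuous fun ν : PathSpace a => ν.1 j :=
      (continuous_apply j).comp continuous_subtype_val
    exact (isOpen_discrete ({μ.1 j} : Set (Fin n))).preimage hc

/-- If every row of `a` is nonzero and `μ` is the only path with initial word
`μ 0, …, μ N`, then the letters of `μ` from position `N` on have a unique successor. -/
theorem unique_successors_of_determined {n : ℕ} {a : Fin n → Fin n → Bool}
    (hA : ∀ i, ∃ j, a i j = true) {μ : PathSpace a} {N : ℕ}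
    (hN : ∀ ν : PathSpace a, (∀ j, j ≤ N → ν.1 j = μ.1 j) → ν = μ) {j : ℕ} (hj : N ≤ j) :
    ∃! k, a (μ.1 j) k = true := by
  refine ⟨μ.1 (j + 1), μ.2 j, fun k hk => ?_⟩
  choose f hf using hA
  let ν : PathSpace a := ⟨fun i => if i ≤ j then μ.1 i else f^[i - (j + 1)] k, fun i => by
    dsimp only
    rcases lt_trichotomy i j with h | rfl | h
    · rw [if_pos h.le, if_pos (Nat.succ_le_of_lt h)]
      exact μ.2 i
    · simpa using hk
    · rw [if_neg (by omega), if_neg (by omega),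
        show i + 1 - (j + 1) = (i - (j + 1)) + 1 by omega, Function.iterate_succ_apply']
      exact hf _⟩
  have hν : ν = μ := hN ν fun i hi => if_pos (hi.trans hj)
  have hval : ν.1 (j + 1) = μ.1 (j + 1) := by rw [hν]
  simpa [ν] using hval

/-- Every letter of `xγγγ⋯` from position `|x|` on is a letter of `γ`. -/
theorem EqWordThenCycle.mem_cycle {n : ℕ} {μ : ℕ → Fin n} {x γ : List (Fin n)}
    (h : EqWordThenCycle μ x γ) (hγ : γ ≠ []) (j : ℕ) : μ (x.length + j) ∈ γ := by
  induction j using Nat.strong_induction_on with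
  | _ j ih =>
    rcases Nat.lt_or_ge j γ.length with hj | hj
    · rw [h.2.1 j hj]
      exact List.get_mem _ _
    · have hpos := List.length_pos_iff.mpr hγ
      have hper := h.2.2 (j - γ.length)
      rw [show x.length + γ.length + (j - γ.length) = x.length + j by omega] at hper
      rw [hper]
      exact ih _ (by omega)

/-- The concatenation of two consecutive segments of a sequence. -/
theorem ofFn_append_ofFn_add {α : Type*} (μ : ℕ → α) (p l : ℕ) :
    (List.ofFn fun i : Fin p => μ i) ++ (List.ofFn fun i : Fin l => μ (p + i)) =
      List.ofFn fun i : Fin (p + l) => μ i := by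
  rw [List.ofFn_add]
  rfl

/-- Segments of a path are admissible. -/
theorem admissibleWord_ofFn {n : ℕ} {a : Fin n → Fin n → Bool} {μ : ℕ → Fin n}
    (hμ : ∀ j, a (μ j) (μ (j + 1)) = true) (l : ℕ) :
    AdmissibleWord a (List.ofFn fun i : Fin l => μ i) := by
  refine List.isChain_iff_getElem.mpr fun i hi => ?_
  simpa using hμ i

/-- a path `μ ∈ P_A^∞` is an isolated point of `P_A^∞` if and only if
`μ = xγγγ⋯` for some (possibly empty) admissible word `x` and terminal circuit `γ`
with `xγ` admissible. -/
theorem stmt_15 (n : ℕ) (hn : 1 ≤ n) (a : Fin n → Fin n → Bool)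
    (hA : ∀ i, ∃ j, a i j = true) (μ : PathSpace a) :
    IsOpen ({μ} : Set (PathSpace a)) ↔
      ∃ x γ : List (Fin n),
        AdmissibleWord a (x ++ γ) ∧ IsCircuit a γ ∧ IsTerminal a γ ∧
        EqWordThenCycle μ.1 x γ := by
  rw [isOpen_singleton_path_iff]
  constructor
  · rintro ⟨N, hN⟩
    have hu : ∀ j, N ≤ j → ∃! k, a (μ.1 j) k = true :=
      fun j hj => unique_successors_of_determined hA hN hj
    obtain ⟨s, t, hst, hrep⟩ : ∃ s t, s < t ∧ μ.1 (N + s) = μ.1 (N + t) := by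
      obtain ⟨s, t, hne, he⟩ := Finite.exists_ne_map_eq_of_infinite fun s => μ.1 (N + s)
      rcases lt_or_gt_of_ne hne with h | h
      · exact ⟨s, t, h, he⟩
      · exact ⟨t, s, h, he.symm⟩
    obtain ⟨l, hl, rfl⟩ : ∃ l, 0 < l ∧ t = s + l := ⟨t - s, by omega, by omega⟩
    set p := N + s with hp
    have hper : ∀ j, μ.1 (p + l + j) = μ.1 (p + j) := by
      intro j
      induction j with
      | zero => simpa [hp, add_assoc] using hrep.symm
      | succ j ih =>
        have hstep := μ.2 (p + l + j)
        rw [ih] at hstep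
        exact (hu (p + j) (by omega)).unique hstep (μ.2 (p + j))
    refine ⟨List.ofFn fun i : Fin p => μ.1 i, List.ofFn fun i : Fin l => μ.1 (p + i),
      ?_, ⟨?_, ?_⟩, ?_, ?_, ?_, ?_⟩
    · rw [ofFn_append_ofFn_add]
      exact admissibleWord_ofFn μ.2 _
    · simpa [List.ofFn_eq_nil_iff] using hl.ne'
    · have hsecond : (List.ofFn fun i : Fin l => μ.1 (p + i)) =
          List.ofFn fun i : Fin l => μ.1 (p + (l + i)) := by
        congr 1
        funext i
        rw [← hper, add_assoc]
      nth_rewrite 2 [hsecond]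
      rw [ofFn_append_ofFn_add fun i => μ.1 (p + i)]
      exact admissibleWord_ofFn (μ := fun i => μ.1 (p + i)) (fun j => μ.2 (p + j)) _
    · intro i hi
      obtain ⟨j, rfl⟩ := List.mem_ofFn.mp hi
      exact hu _ (by omega)
    · intro j hj
      simp
    · intro j hj
      simp
    · intro j
      simpa using hper j
  · rintro ⟨x, γ, -, ⟨hγ, -⟩, hterm, hμ⟩
    refine ⟨x.length, fun ν hν => path_eq_of_unique_successors (fun j hj => ?_) hν⟩
    obtain ⟨j, rfl⟩ := Nat.exists_eq_add_of_le hj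
    exact hterm _ (hμ.mem_cycle hγ j)
end

section
/- Let μ ∈ P_A^∞ and let r, s be admissible words (possibly empty) such that the group element t := r s⁻¹ of 𝔽_n is not the identity, s is an initial segment of μ (i.e. s = μ_1⋯μ_{|s|}), and the concatenation of r with the shifted path μ_{|s|+1}μ_{|s|+2}⋯ equals μ. Then there is a nonempty admissible circuit γ such that either r = sγ and μ = sγγγ⋯, or s = rγ and μ = rγγγ⋯; in particular t = xγx⁻¹ or t = xγ⁻¹x⁻¹ in 𝔽_n, where x is the shorter of r and s. Conversely, if μ = xγγγ⋯ for some admissible word x and nonempty admissible circuit γ with xγ admissible, then r := xγ and s := x satisfy the above hypotheses with t = xγx⁻¹ ≠ e. -/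
theorem wordToF_append {n : ℕ} (l m : List (Fin n)) :
    wordToF (l ++ m) = wordToF l * wordToF m := by
  simp [wordToF]

theorem wordToF_ne_one {n : ℕ} {l : List (Fin n)} (hl : l ≠ []) : wordToF l ≠ 1 := by
  have key : ∀ l : List (Fin n),
      FreeGroup.lift (fun _ => Multiplicative.ofAdd (1 : ℤ)) (wordToF l)
        = Multiplicative.ofAdd (l.length : ℤ) := by
    intro l
    induction l with
    | nil => simp [wordToF]
    | cons i l ih =>
      rw [← List.singleton_append, wordToF_append, map_mul, ih]
      simp [wordToF, ← ofAdd_add, add_comm]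
  intro h
  have h1 := key l
  rw [h, map_one] at h1
  have h2 : (0 : ℤ) = l.length := congrArg Multiplicative.toAdd h1
  exact hl (List.length_eq_zero_iff.mp (by omega))

theorem eq_map_range_of_initial {n : ℕ} {μ : ℕ → Fin n} {l : List (Fin n)}
    (h : ∀ j : ℕ, ∀ hj : j < l.length, μ j = l.get ⟨j, hj⟩) :
    l = (List.range l.length).map μ := by
  apply List.ext_getElem
  · simp
  · intro i h1 h2
    simpa using (h i h1).symm

theorem admissibleWord_map_range {n : ℕ} {a : Fin n → Fin n → Bool} {μ : ℕ → Fin n}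
    (hμ : ∀ j : ℕ, a (μ j) (μ (j + 1)) = true) (k : ℕ) :
    AdmissibleWord a ((List.range k).map μ) := by
  unfold AdmissibleWord
  refine List.isChain_iff_getElem.mpr fun i hi => ?_
  simpa using hμ i

/-- Two distinct initial segments of a path with the same tail differ by a circuit. -/
theorem exists_circuit_of_length_lt {n : ℕ} {a : Fin n → Fin n → Bool} {μ : ℕ → Fin n}
    (hμ : ∀ j : ℕ, a (μ j) (μ (j + 1)) = true) {r s : List (Fin n)}
    (hs : ∀ j : ℕ, ∀ h : j < s.length, μ j = s.get ⟨j, h⟩)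
    (hr : ∀ j : ℕ, ∀ h : j < r.length, μ j = r.get ⟨j, h⟩)
    (hp : ∀ j : ℕ, μ (r.length + j) = μ (s.length + j)) (hlt : s.length < r.length) :
    ∃ γ : List (Fin n), IsCircuit a γ ∧ r = s ++ γ ∧ EqWordThenCycle μ s γ := by
  obtain ⟨d, hd⟩ := Nat.exists_eq_add_of_lt hlt
  set γ := (List.range (d + 1)).map (fun j => μ (s.length + j)) with hγ
  have hlen : γ.length = d + 1 := by simp [hγ]
  have hper : ∀ j, μ (s.length + (d + 1 + j)) = μ (s.length + j) := by
    intro j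
    rw [← hp j, hd]
    congr 1
    omega
  refine ⟨γ, ⟨?_, ?_⟩, ?_, hs, ?_, ?_⟩
  · intro h
    simp [h] at hlen
  · have hγγ : γ ++ γ = (List.range (d + 1 + (d + 1))).map (fun j => μ (s.length + j)) := by
      rw [List.range_add, List.map_append, List.map_map, hγ]
      congr 1
      exact List.map_congr_left fun j _ => (hper j).symm
    rw [hγγ]
    exact admissibleWord_map_range (fun j => hμ (s.length + j)) _
  · rw [eq_map_range_of_initial hr, hd, add_assoc, List.range_add, List.map_append,
      List.map_map, ← eq_map_range_of_initial hs]
    rfl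
  · intro j h
    simp [hγ]
  · intro j
    rw [hlen, add_assoc, hper]

/-- Let `μ ∈ P_A^∞`.
Forward: if `r, s` are admissible words such that `t := r s⁻¹ ≠ e` in `𝔽_n`, `s` is an
initial segment of `μ`, and the concatenation of `r` with the shifted path
`μ_{|s|+1}μ_{|s|+2}⋯` equals `μ`, then there is a nonempty admissible circuit `γ` with
either `r = sγ` and `μ = sγγγ⋯` (so `t = sγs⁻¹`), or `s = rγ` and `μ = rγγγ⋯`
(so `t = rγ⁻¹r⁻¹`).
Converse: if `μ = xγγγ⋯` with `x` admissible, `γ` a nonempty admissible circuit and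
`xγ` admissible, then `r := xγ` and `s := x` satisfy the above hypotheses, with
`t = xγx⁻¹ ≠ e`. -/
theorem stmt_16 (n : ℕ) (hn : 1 ≤ n) (a : Fin n → Fin n → Bool)
    (hA : ∀ i, ∃ j, a i j = true)
    (μ : ℕ → Fin n) (hμ : ∀ j : ℕ, a (μ j) (μ (j + 1)) = true) :
    (∀ r s : List (Fin n), AdmissibleWord a r → AdmissibleWord a s →
      wordToF r * (wordToF s)⁻¹ ≠ 1 →
      (∀ j : ℕ, ∀ h : j < s.length, μ j = s.get ⟨j, h⟩) →
      (∀ j : ℕ, ∀ h : j < r.length, μ j = r.get ⟨j, h⟩) →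
      (∀ j : ℕ, μ (r.length + j) = μ (s.length + j)) →
      ∃ γ : List (Fin n), IsCircuit a γ ∧
        ((r = s ++ γ ∧ EqWordThenCycle μ s γ ∧
            wordToF r * (wordToF s)⁻¹ = wordToF s * wordToF γ * (wordToF s)⁻¹) ∨
         (s = r ++ γ ∧ EqWordThenCycle μ r γ ∧
            wordToF r * (wordToF s)⁻¹ = wordToF r * (wordToF γ)⁻¹ * (wordToF r)⁻¹))) ∧
    (∀ x γ : List (Fin n), AdmissibleWord a (x ++ γ) → IsCircuit a γ →
      EqWordThenCycle μ x γ →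
      AdmissibleWord a (x ++ γ) ∧ AdmissibleWord a x ∧
      (∀ j : ℕ, ∀ h : j < x.length, μ j = x.get ⟨j, h⟩) ∧
      (∀ j : ℕ, ∀ h : j < (x ++ γ).length, μ j = (x ++ γ).get ⟨j, h⟩) ∧
      (∀ j : ℕ, μ ((x ++ γ).length + j) = μ (x.length + j)) ∧
      wordToF (x ++ γ) * (wordToF x)⁻¹ = wordToF x * wordToF γ * (wordToF x)⁻¹ ∧
      wordToF (x ++ γ) * (wordToF x)⁻¹ ≠ 1) := by
  refine ⟨fun r s _ _ hne hs hr hp => ?_, fun x γ hxγ hγ hμxγ => ?_⟩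
  · rcases lt_trichotomy s.length r.length with hlt | heq | hlt
    · obtain ⟨γ, hγ, hrs, hcyc⟩ := exists_circuit_of_length_lt hμ hs hr hp hlt
      exact ⟨γ, hγ, .inl ⟨hrs, hcyc, by rw [hrs, wordToF_append]⟩⟩
    · refine absurd ?_ hne
      rw [eq_map_range_of_initial hs, eq_map_range_of_initial hr, heq, mul_inv_cancel]
    · obtain ⟨γ, hγ, hsr, hcyc⟩ :=
        exists_circuit_of_length_lt hμ hr hs (fun j => (hp j).symm) hlt
      exact ⟨γ, hγ, .inr ⟨hsr, hcyc, by rw [hsr, wordToF_append, mul_inv_rev, mul_assoc]⟩⟩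
  · obtain ⟨hx, hcyc, hper⟩ := hμxγ
    refine ⟨hxγ, List.IsChain.left_of_append hxγ, hx, fun j h => ?_, fun j => ?_, ?_, ?_⟩
    · rw [List.get_eq_getElem, List.getElem_append]
      split
      · exact hx j _
      · rename_i hj
        replace hj : ¬ j < x.length := hj
        have hjx : x.length + (j - x.length) = j := by omega
        rw [List.length_append] at h
        have := hcyc (j - x.length) (by omega)
        rwa [hjx] at this
    · rw [List.length_append, hper]
    · rw [wordToF_append]
    · rw [wordToF_append, Ne, conj_eq_one_iff]
      exact wordToF_ne_one hγ.1
end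

section
/- Suppose the matrix A has no terminal circuits. Let (s_i)_{i=1}^n and (s_i')_{i=1}^n be Cuntz–Krieger A-families on complex Hilbert spaces H and H' respectively, with s_i ≠ 0 and s_i' ≠ 0 for every i. Then there is an isometric *-isomorphism from the C*-algebra generated by {s_1,…,s_n} in B(H) (the norm closure of the *-subalgebra generated by the s_i) onto the C*-algebra generated by {s_1',…,s_n'} in B(H'), carrying s_i to s_i' for each i. -/
open ContinuousLinearMap

/-- `s` is a Cuntz–Krieger `A`-family: partial isometries with `∑_j s_j s_j* = 1` and
`∑_j a_{ij} s_j s_j* = s_i* s_i` for each `i`. -/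
def IsCKFamily {n : ℕ} (a : Fin n → Fin n → Bool) {H : Type*} [NormedAddCommGroup H]
    [InnerProductSpace ℂ H] [CompleteSpace H] (s : Fin n → H →L[ℂ] H) : Prop :=
  (∀ i, s i * adjoint (s i) * s i = s i) ∧
  (∑ j, s j * adjoint (s j) = 1) ∧
  (∀ i, ∑ j, (if a i j = true then s j * adjoint (s j) else 0) =
    adjoint (s i) * s i)

section Word

variable {n : ℕ} {a : Fin n → Fin n → Bool} {R : Type*} [Ring R]

/-- The Cuntz–Krieger relations in a star ring, including orthogonality of the ranges. -/
structure CKRelations [StarRing R] (a : Fin n → Fin n → Bool) (t : Fin n → R) : Prop where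
  orth : ∀ i j, i ≠ j → star (t i) * t j = 0
  sum_range : ∑ j, t j * star (t j) = 1
  source : ∀ i, star (t i) * t i = ∑ j, if a i j = true then t j * star (t j) else 0

/-- The product of the generators along a word. -/
def wordProd (t : Fin n → R) (l : List (Fin n)) : R := (l.map t).prod

@[simp] lemma wordProd_nil (t : Fin n → R) : wordProd t [] = 1 := by simp [wordProd]

@[simp] lemma wordProd_cons (t : Fin n → R) (i : Fin n) (l : List (Fin n)) :
    wordProd t (i :: l) = t i * wordProd t l := by simp [wordProd]

lemma wordProd_append (t : Fin n → R) (l m : List (Fin n)) :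
    wordProd t (l ++ m) = wordProd t l * wordProd t m := by simp [wordProd]

lemma admissibleWord_singleton (a : Fin n → Fin n → Bool) (j : Fin n) :
    AdmissibleWord a [j] := List.isChain_singleton j

lemma admissibleWord_cons_cons {i j : Fin n} {l : List (Fin n)} :
    AdmissibleWord a (i :: j :: l) ↔ a i j = true ∧ AdmissibleWord a (j :: l) :=
  List.isChain_cons_cons

namespace CKRelations

variable [StarRing R] {t : Fin n → R} (ht : CKRelations a t)
include ht

lemma range_mul (j : Fin n) : t j * star (t j) * t j = t j := by
  have h : (∑ i, t i * star (t i)) * t j = t j := by rw [ht.sum_range, one_mul]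
  rwa [Finset.sum_mul, Finset.sum_eq_single j] at h
  · intro i _ hij
    rw [mul_assoc, ht.orth i j hij, mul_zero]
  · simp

lemma source_mul (i j : Fin n) :
    star (t i) * t i * t j = if a i j = true then t j else 0 := by
  rw [ht.source, Finset.sum_mul, Finset.sum_eq_single j]
  · split_ifs
    · exact ht.range_mul j
    · simp
  · intro k _ hk
    split_ifs
    · rw [mul_assoc, ht.orth k j hk, mul_zero]
    · simp
  · simp

lemma star_wordProd_mul_eq_zero {μ ν : List (Fin n)} (h : μ.length = ν.length) (hne : μ ≠ ν) :
    star (wordProd t μ) * wordProd t ν = 0 := by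
  induction μ generalizing ν with
  | nil => exact absurd (List.length_eq_zero_iff.mp h.symm).symm hne
  | cons i μ ih =>
    cases ν with
    | nil => simp at h
    | cons j ν =>
      have key : star (wordProd t (i :: μ)) * wordProd t (j :: ν)
          = star (wordProd t μ) * (star (t i) * t j * wordProd t ν) := by
        simp [mul_assoc]
      rw [key]
      by_cases hij : i = j
      · subst hij
        have hlen : μ.length = ν.length := by simpa using h
        have hne' : μ ≠ ν := by simpa using hne
        cases ν with
        | nil => exact absurd (List.length_eq_zero_iff.mp hlen) hne'
        | cons k ν =>
          have := ih hlen hne'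
          rw [wordProd_cons] at this ⊢
          rw [← mul_assoc (star (t i) * t i), ht.source_mul]
          split_ifs
          · exact this
          · simp
      · rw [ht.orth i j hij]; simp

open Classical in
lemma star_wordProd_mul_self_mul (μ : List (Fin n)) (j : Fin n) :
    star (wordProd t μ) * wordProd t μ * t j =
      if AdmissibleWord a (μ ++ [j]) then t j else 0 := by
  induction μ with
  | nil => simp [admissibleWord_singleton]
  | cons i μ ih =>
    have key : star (wordProd t (i :: μ)) * wordProd t (i :: μ) * t j
        = star (wordProd t μ) * (star (t i) * t i * wordProd t (μ ++ [j])) := by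
      simp [mul_assoc, wordProd_append]
    rw [key]
    have h2 : ∀ k ρ, μ ++ [j] = k :: ρ → star (wordProd t μ) *
        (star (t i) * t i * wordProd t (μ ++ [j])) =
        if AdmissibleWord a (i :: μ ++ [j]) then t j else 0 := by
      intro k ρ hk
      rw [List.cons_append, hk, admissibleWord_cons_cons, wordProd_cons,
        ← mul_assoc (star (t i) * t i), ht.source_mul, ← hk]
      by_cases hik : a i k = true
      · rw [if_pos hik, ← wordProd_cons, ← hk, wordProd_append]
        simpa [hik, mul_assoc] using ih
      · simp [hik]
    cases μ with
    | nil => exact h2 j [] rfl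
    | cons k μ => exact h2 k _ rfl

lemma wordProd_eq_zero {μ : List (Fin n)} (h : ¬ AdmissibleWord a μ) : wordProd t μ = 0 := by
  induction μ with
  | nil => exact absurd List.isChain_nil h
  | cons i μ ih =>
    cases μ with
    | nil => exact absurd (admissibleWord_singleton a i) h
    | cons j μ =>
      by_cases hij : a i j = true
      · rw [admissibleWord_cons_cons] at h
        rw [wordProd_cons, ih (fun h' => h ⟨hij, h'⟩), mul_zero]
      · have : t i * t j = 0 := by
          rw [← ht.range_mul i, mul_assoc, mul_assoc, ← mul_assoc (star (t i)),
            ht.source_mul, if_neg hij, mul_zero]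
        rw [wordProd_cons, wordProd_cons, ← mul_assoc, this, zero_mul]

lemma wordProd_ne_zero (h0 : ∀ i, t i ≠ 0) {i : Fin n} {μ : List (Fin n)}
    (h : AdmissibleWord a (i :: μ)) : wordProd t (i :: μ) ≠ 0 := by
  induction μ generalizing i with
  | nil => simpa using h0 i
  | cons j μ ih =>
    rw [admissibleWord_cons_cons] at h
    intro hz
    apply ih h.2
    have : star (t i) * wordProd t (i :: j :: μ) = wordProd t (j :: μ) := by
      rw [wordProd_cons, wordProd_cons, ← mul_assoc, ← mul_assoc, ht.source_mul, if_pos h.1]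
    rw [← this, hz, mul_zero]

open Classical in
lemma star_wordProd_mul_self (μ : List (Fin n)) :
    star (wordProd t μ) * wordProd t μ =
      ∑ j, if AdmissibleWord a (μ ++ [j]) then t j * star (t j) else 0 := by
  rw [← mul_one (star (wordProd t μ) * wordProd t μ), ← ht.sum_range, Finset.mul_sum]
  refine Finset.sum_congr rfl fun j _ => ?_
  rw [← mul_assoc, ht.star_wordProd_mul_self_mul]
  split_ifs <;> simp

lemma wordProd_mul_star (μ ν : List (Fin n)) : wordProd t μ * star (wordProd t ν) =
    ∑ j, wordProd t (μ ++ [j]) * star (wordProd t (ν ++ [j])) := by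
  rw [← mul_one (wordProd t μ), ← ht.sum_range, Finset.mul_sum, Finset.sum_mul]
  simp [wordProd_append, mul_assoc]

lemma star_wordProd_mul_wordProd_mul {ν β : List (Fin n)} (h : ν.length ≤ β.length) (j : Fin n) :
    star (wordProd t ν) * wordProd t β * t j = 0 ∨
      ∃ τ, τ.length + ν.length = β.length ∧
        star (wordProd t ν) * wordProd t β * t j = wordProd t τ * t j := by
  obtain ⟨β₁, β₂, rfl, hl⟩ : ∃ β₁ β₂, β = β₁ ++ β₂ ∧ ν.length = β₁.length :=
    ⟨β.take ν.length, β.drop ν.length, (List.take_append_drop _ _).symm, by simp [h]⟩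
  by_cases hne : ν = β₁
  · subst hne
    have key : ∀ k ρ, β₂ ++ [j] = k :: ρ →
        star (wordProd t ν) * wordProd t (ν ++ β₂) * t j = 0 ∨
        star (wordProd t ν) * wordProd t (ν ++ β₂) * t j = wordProd t β₂ * t j := by
      intro k ρ hk
      have e : wordProd t β₂ * t j = t k * wordProd t ρ := by
        rw [← wordProd_cons, ← hk, wordProd_append]; simp
      have e2 : star (wordProd t ν) * wordProd t (ν ++ β₂) * t j =
          star (wordProd t ν) * wordProd t ν * t k * wordProd t ρ := by
        rw [wordProd_append]; simp only [mul_assoc, e]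
      rw [e2, e, ht.star_wordProd_mul_self_mul]
      split_ifs
      · exact Or.inr rfl
      · left; simp
    obtain ⟨k, ρ, hk⟩ : ∃ k ρ, β₂ ++ [j] = k :: ρ := List.exists_cons_of_ne_nil (by simp)
    exact (key k ρ hk).imp id fun h => ⟨β₂, by simp [add_comm], h⟩
  · left
    rw [wordProd_append, ← mul_assoc, ht.star_wordProd_mul_eq_zero hl hne, zero_mul, zero_mul]

/-- A word that is not a prefix of `τ ++ l` kills the compression of the word `τ` to its range. -/
lemma star_wordProd_mul_wordProd_append_eq_zero {l : List (Fin n)} {M : ℕ}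
    (hl : ∀ τ : List (Fin n), τ ≠ [] → τ.length ≤ M → ¬ l <+: τ ++ l)
    {σ τ : List (Fin n)} (hlt : σ.length < τ.length) (hτ : τ.length ≤ M) :
    star (wordProd t (σ ++ l)) * wordProd t (τ ++ l) = 0 := by
  have h1 : (σ ++ l).length ≤ (τ ++ l).length := by simp; omega
  rw [← List.take_append_drop (σ ++ l).length (τ ++ l), wordProd_append t (List.take _ _), ← mul_assoc,
    ht.star_wordProd_mul_eq_zero, zero_mul]
  · rw [List.length_take, min_eq_left h1]
  · intro he
    have hp : σ ++ l <+: τ ++ l := List.prefix_iff_eq_take.mpr he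
    have hσ : σ <+: τ := List.prefix_of_prefix_length_le
      ((List.prefix_append σ l).trans hp) (List.prefix_append τ l) hlt.le
    obtain ⟨ρ, rfl⟩ := hσ
    rw [List.append_assoc, List.prefix_append_right_inj] at hp
    refine hl ρ ?_ ?_ hp
    · rintro rfl; simp at hlt
    · simp at hτ; omega

end CKRelations

end Word

section Graded

variable {n : ℕ} {a : Fin n → Fin n → Bool} {R : Type*} [Ring R] [StarRing R] [Algebra ℂ R]

/-- The span of the products `t_μ t_ν*` with `|μ| = k` and `|ν| = l`. -/
def homogSpan (t : Fin n → R) (k l : ℕ) : Submodule ℂ R :=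
  Submodule.span ℂ {x | ∃ μ ν : List (Fin n), μ.length = k ∧ ν.length = l ∧
    x = wordProd t μ * star (wordProd t ν)}

/-- The span of the products `t_μ t_ν*` with `|μ| ≤ M`, `|ν| ≤ M` and `|μ| ≠ |ν|`. -/
def offDiagSpan (t : Fin n → R) (M : ℕ) : Submodule ℂ R :=
  Submodule.span ℂ {x | ∃ μ ν : List (Fin n), μ.length ≤ M ∧ ν.length ≤ M ∧
    μ.length ≠ ν.length ∧ x = wordProd t μ * star (wordProd t ν)}

/-- The span of the products `t_μ t_ν*` with `|μ| < K` and `|ν| = N`. -/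
def filtSpan (t : Fin n → R) (K N : ℕ) : Submodule ℂ R :=
  ⨆ k ∈ Finset.range K, homogSpan t k N

lemma homogSpan_le_offDiagSpan (t : Fin n → R) {k l M : ℕ} (hk : k ≤ M) (hl : l ≤ M)
    (hkl : k ≠ l) : homogSpan t k l ≤ offDiagSpan t M := by
  refine Submodule.span_mono ?_
  rintro x ⟨μ, ν, rfl, rfl, rfl⟩
  exact ⟨μ, ν, hk, hl, hkl, rfl⟩

lemma homogSpan_le_filtSpan (t : Fin n → R) {k K : ℕ} (N : ℕ) (hk : k < K) :
    homogSpan t k N ≤ filtSpan t K N :=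
  le_biSup (fun k => homogSpan t k N) (Finset.mem_range.mpr hk)

lemma mem_filtSpan_iff {t : Fin n → R} {K N : ℕ} {x : R} : x ∈ filtSpan t K N ↔
    ∃ y : ℕ → R, (∀ k, y k ∈ homogSpan t k N) ∧ ∑ k ∈ Finset.range K, y k = x := by
  rw [filtSpan, Submodule.mem_iSup_finset_iff_exists_sum]
  constructor
  · rintro ⟨y, rfl⟩
    exact ⟨fun k => y k, fun k => (y k).2, rfl⟩
  · rintro ⟨y, hy, rfl⟩
    exact ⟨fun k => ⟨y k, hy k⟩, rfl⟩

lemma star_mem_homogSpan [StarModule ℂ R] {t : Fin n → R} {k l : ℕ} {x : R}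
    (hx : x ∈ homogSpan t k l) : star x ∈ homogSpan t l k := by
  induction hx using Submodule.span_induction with
  | mem x hx =>
    obtain ⟨μ, ν, hμ, hν, rfl⟩ := hx
    exact Submodule.subset_span ⟨ν, μ, hν, hμ, by simp⟩
  | zero => simp
  | add x y _ _ hx hy => rw [star_add]; exact add_mem hx hy
  | smul c x _ hx => rw [star_smul]; exact Submodule.smul_mem _ _ hx

namespace CKRelations

variable {t : Fin n → R} (ht : CKRelations a t)
include ht

lemma homogSpan_le_add (k l m : ℕ) : homogSpan t k l ≤ homogSpan t (k + m) (l + m) := by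
  induction m with
  | zero => exact le_rfl
  | succ m ih =>
    refine ih.trans (Submodule.span_le.mpr ?_)
    rintro x ⟨μ, ν, hμ, hν, rfl⟩
    rw [ht.wordProd_mul_star]
    exact sum_mem fun j _ => Submodule.subset_span ⟨_, _, by simp [hμ, add_assoc],
      by simp [hν, add_assoc], rfl⟩

lemma mul_mem_homogSpan_of_eq {k l q : ℕ} {x y : R} (hx : x ∈ homogSpan t k l)
    (hy : y ∈ homogSpan t l q) : x * y ∈ homogSpan t (k + 1) (q + 1) := by
  classical
  have key : homogSpan t k l * homogSpan t l q ≤ homogSpan t (k + 1) (q + 1) := by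
    rw [homogSpan, homogSpan, Submodule.span_mul_span, Submodule.span_le]
    rintro _ ⟨_, ⟨μ, ν, hμ, hν, rfl⟩, _, ⟨μ', ν', hμ', hν', rfl⟩, rfl⟩
    have e : wordProd t μ * star (wordProd t ν) * (wordProd t μ' * star (wordProd t ν')) =
      wordProd t μ * (star (wordProd t ν) * wordProd t μ') * star (wordProd t ν') := by
      simp only [mul_assoc]
    simp only [e, SetLike.mem_coe]
    by_cases hne : ν = μ'
    · subst hne
      rw [ht.star_wordProd_mul_self, Finset.mul_sum, Finset.sum_mul]
      refine sum_mem fun j _ => ?_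
      split_ifs
      · exact Submodule.subset_span ⟨μ ++ [j], ν' ++ [j], by simp [hμ], by simp [hν'],
          by simp [wordProd_append, mul_assoc]⟩
      · simp
    · rw [ht.star_wordProd_mul_eq_zero (hν.trans hμ'.symm) hne]
      simp
  exact key (Submodule.mul_mem_mul hx hy)

lemma mul_mem_homogSpan {k l p q : ℕ} {x y : R} (hx : x ∈ homogSpan t k l)
    (hy : y ∈ homogSpan t p q) : x * y ∈ homogSpan t (k + p + 1) (l + q + 1) := by
  have hx' := ht.homogSpan_le_add k l p hx
  have hy' := ht.homogSpan_le_add p q l hy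
  rw [add_comm p l, add_comm q l] at hy'
  exact ht.mul_mem_homogSpan_of_eq hx' hy'

lemma filtSpan_le_filtSpan {K K' N N' m : ℕ} (hK : K + m ≤ K') (hN : N + m = N') :
    filtSpan t K N ≤ filtSpan t K' N' := by
  subst hN
  refine iSup₂_le fun k hk => ?_
  rw [Finset.mem_range] at hk
  exact (ht.homogSpan_le_add k N m).trans (homogSpan_le_filtSpan t _ (by omega))

lemma mul_mem_filtSpan {K L N M : ℕ} {x y : R} (hx : x ∈ filtSpan t K N)
    (hy : y ∈ filtSpan t L M) : x * y ∈ filtSpan t (K + L) (N + M + 1) := by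
  obtain ⟨x', hx', rfl⟩ := mem_filtSpan_iff.mp hx
  obtain ⟨y', hy', rfl⟩ := mem_filtSpan_iff.mp hy
  rw [Finset.sum_mul_sum]
  refine sum_mem fun k hk => sum_mem fun l hl => ?_
  rw [Finset.mem_range] at hk hl
  exact homogSpan_le_filtSpan t _ (k := k + l + 1) (by omega) (ht.mul_mem_homogSpan (hx' k) (hy' l))

lemma pow_mem_filtSpan {K N : ℕ} {x : R} (hx : x ∈ filtSpan t K N) (m : ℕ) :
    ∃ N', x ^ (m + 1) ∈ filtSpan t ((m + 1) * K) N' := by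
  induction m with
  | zero => exact ⟨N, by simpa using hx⟩
  | succ m ih =>
    obtain ⟨N', h⟩ := ih
    refine ⟨N' + N + 1, ?_⟩
    rw [pow_succ, add_mul (m + 1), one_mul]
    exact ht.mul_mem_filtSpan h hx

lemma exists_mem_filtSpan [StarModule ℂ R] {x : R}
    (hx : x ∈ StarAlgebra.adjoin ℂ (Set.range t)) : ∃ K N, x ∈ filtSpan t K N := by
  induction hx using StarAlgebra.adjoin_induction with
  | mem x hx =>
    obtain ⟨i, rfl⟩ := hx
    exact ⟨2, 0, homogSpan_le_filtSpan t 0 one_lt_two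
      (Submodule.subset_span ⟨[i], [], rfl, rfl, by simp⟩)⟩
  | algebraMap r =>
    refine ⟨1, 0, homogSpan_le_filtSpan t 0 one_pos ?_⟩
    rw [Algebra.algebraMap_eq_smul_one]
    exact Submodule.smul_mem _ _ (Submodule.subset_span ⟨[], [], rfl, rfl, by simp⟩)
  | add x y _ _ hx hy =>
    obtain ⟨K, N, hx⟩ := hx
    obtain ⟨L, M, hy⟩ := hy
    exact ⟨K + M + (L + N), N + M, add_mem
      (ht.filtSpan_le_filtSpan (m := M) (by omega) rfl hx)
      (ht.filtSpan_le_filtSpan (m := N) (by omega) (by omega) hy)⟩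
  | mul x y _ _ hx hy =>
    obtain ⟨K, N, hx⟩ := hx
    obtain ⟨L, M, hy⟩ := hy
    exact ⟨_, _, ht.mul_mem_filtSpan hx hy⟩
  | star x _ hx =>
    obtain ⟨K, N, hx⟩ := hx
    obtain ⟨y, hy, rfl⟩ := mem_filtSpan_iff.mp hx
    refine ⟨N + K + 1, K, ?_⟩
    rw [star_sum]
    refine sum_mem fun k hk => ?_
    rw [Finset.mem_range] at hk
    have := ht.homogSpan_le_add N k (K - k) (star_mem_homogSpan (hy k))
    rw [show k + (K - k) = K by omega] at this
    exact homogSpan_le_filtSpan t _ (by omega) this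

end CKRelations

end Graded

section Aperiodic

variable {n : ℕ} {a : Fin n → Fin n → Bool}

lemma admissibleWord_map_range_s18 (f : ℕ → Fin n) (L : ℕ) :
    AdmissibleWord a ((List.range L).map f) ↔ ∀ i, i + 1 < L → a (f i) (f (i + 1)) = true := by
  unfold AdmissibleWord
  refine (List.isChain_map f).trans ((List.isChain_range _ L).trans ?_)
  exact ⟨fun h i hi => h i (by omega), fun h i hi => h i (by omega)⟩

/-- In the absence of terminal circuits, every letter starts an admissible sequence with a
finite stretch that has no period `q` with `1 ≤ q ≤ M`. -/
lemma exists_aperiodic_sequence (hA : ∀ i, ∃ j, a i j = true)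
    (hNT : ¬ ∃ γ : List (Fin n), IsCircuit a γ ∧ IsTerminal a γ) (j : Fin n) (M : ℕ) :
    ∃ (g : ℕ → Fin n) (L : ℕ), g 0 = j ∧ 0 < L ∧
      (∀ i, i + 1 < L → a (g i) (g (i + 1)) = true) ∧
      ∀ q, 1 ≤ q → q ≤ M → ∃ i, i + q < L ∧ g (i + q) ≠ g i := by
  choose nxt hnxt using hA
  let f : ℕ → Fin n := fun m => nxt^[m] j
  have hf : ∀ i, a (f i) (f (i + 1)) = true := fun i => by
    simp only [f, Function.iterate_succ_apply']; exact hnxt _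
  by_cases hper : ∃ p, 1 ≤ p ∧ ∀ i, f (i + p) = f i
  · obtain ⟨p, hp, hfp⟩ := hper
    have hfmul : ∀ k i, f (i + k * p) = f i := by
      intro k
      induction k with
      | zero => simp
      | succ k ih => intro i; rw [add_mul, one_mul, ← add_assoc, hfp, ih]
    have hγ : IsCircuit a ((List.range p).map f) := by
      refine ⟨by simp; omega, ?_⟩
      have : (List.range p).map f ++ (List.range p).map f = (List.range (p + p)).map f := by
        rw [List.range_add, List.map_append, List.map_map]
        congr 1
        refine List.map_congr_left fun i _ => ?_
        simp [add_comm p i, hfp]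
      rw [this, admissibleWord_map_range_s18]
      exact fun i _ => hf i
    have hnt : ¬ IsTerminal a ((List.range p).map f) := fun h => hNT ⟨_, hγ, h⟩
    simp only [IsTerminal, List.mem_map, not_forall] at hnt
    obtain ⟨_, ⟨m, -, rfl⟩, hm⟩ := hnt
    obtain ⟨w, hw, hwne⟩ : ∃ w, a (f m) w = true ∧ w ≠ f (m + 1) := by
      by_contra! hcon
      exact hm ⟨f (m + 1), hf m, hcon⟩
    let e := m + (M + 1) * p
    have he : M + p ≤ e := by
      simp only [e]; nlinarith [Nat.le_mul_of_pos_right M hp]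
    refine ⟨fun i => if i ≤ e then f i else w, e + 2, by simp [f], by omega, ?_, ?_⟩
    · intro i hi
      by_cases hie : i + 1 ≤ e
      · simp only [if_pos hie, if_pos (show i ≤ e by omega)]
        exact hf i
      · obtain rfl : i = e := by omega
        simp only [le_refl, if_true, if_neg hie]
        rw [hfmul]
        exact hw
    · intro q hq hqM
      by_contra! hcon
      have h1 := hcon (e + 1 - q) (by omega)
      have h2 := hcon (e + 1 - q - p) (by omega)
      have h3 := hfp (e + 1 - q - p)
      have h4 := hfp (e + 1 - p)
      rw [show e + 1 - q - p + p = e + 1 - q by omega] at h3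
      rw [show e + 1 - p + p = e + 1 by omega] at h4
      rw [show e + 1 - q + q = e + 1 by omega, if_neg (by omega), if_pos (by omega)] at h1
      rw [show e + 1 - q - p + q = e + 1 - p by omega, if_pos (by omega), if_pos (by omega)] at h2
      have h5 : f (e + 1) = f (m + 1) := by
        rw [← hfmul (M + 1) (m + 1)]; congr 1; simp only [e]; ring
      apply hwne
      rw [h1, h3, ← h2, ← h4, h5]
  · push Not at hper
    have : ∀ q, ∃ i, 1 ≤ q → f (i + q) ≠ f i := fun q => by
      by_cases hq : 1 ≤ q
      · obtain ⟨i, hi⟩ := hper q hq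
        exact ⟨i, fun _ => hi⟩
      · exact ⟨0, fun h => absurd h hq⟩
    choose idx hidx using this
    refine ⟨f, ∑ q ∈ Finset.range (M + 1), idx q + M + 1, rfl, by omega, fun i _ => hf i, ?_⟩
    intro q hq hqM
    refine ⟨idx q, ?_, hidx q hq⟩
    have := Finset.single_le_sum (f := idx) (fun _ _ => Nat.zero_le _)
      (Finset.mem_range.mpr (show q < M + 1 by omega))
    omega

lemma exists_aperiodic_word (hA : ∀ i, ∃ j, a i j = true)
    (hNT : ¬ ∃ γ : List (Fin n), IsCircuit a γ ∧ IsTerminal a γ) (j : Fin n) (M : ℕ) :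
    ∃ l : List (Fin n), AdmissibleWord a (j :: l) ∧
      ∀ τ : List (Fin n), τ ≠ [] → τ.length ≤ M → ¬ (j :: l) <+: τ ++ (j :: l) := by
  obtain ⟨g, L, hg0, hL, hadm, hap⟩ := exists_aperiodic_sequence hA hNT j M
  obtain ⟨l, hl⟩ : ∃ l, (List.range L).map g = j :: l := by
    obtain ⟨L, rfl⟩ : ∃ L', L = L' + 1 := ⟨L - 1, by omega⟩
    rw [List.range_succ_eq_map]
    exact ⟨_, by rw [List.map_cons, hg0]⟩
  refine ⟨l, ?_, ?_⟩
  · rw [← hl, admissibleWord_map_range_s18]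
    exact hadm
  · rw [← hl]
    intro τ hτ hτM hpre
    obtain ⟨i, hi, hne⟩ := hap τ.length (List.length_pos_iff.mpr hτ) hτM
    apply hne
    have := hpre.getElem (i := i + τ.length) (by simpa using hi)
    rw [List.getElem_append_right (by omega)] at this
    simpa using this

end Aperiodic

section MatrixUnits

variable {ι : Type*} [Fintype ι] [DecidableEq ι]

open scoped Matrix.Norms.L2Operator in
lemma norm_sum_smul_matrixUnits_le {A : Type*} [CStarAlgebra A] (e : ι → ι → A)
    (hmul : ∀ i j k l, e i j * e k l = if j = k then e i l else 0)
    (hstar : ∀ i j, star (e i j) = e j i) (m : Matrix ι ι ℂ) :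
    ‖∑ i, ∑ j, m i j • e i j‖ ≤ ‖m‖ := by
  let φ : Matrix ι ι ℂ →⋆ₙₐ[ℂ] A :=
    { toFun := fun m => ∑ i, ∑ j, m i j • e i j
      map_smul' := fun c m => by simp [Finset.smul_sum, mul_smul]
      map_zero' := by simp
      map_add' := fun m m' => by simp [add_smul, Finset.sum_add_distrib]
      map_mul' := fun m m' => by
        simp only [Matrix.mul_apply, Finset.sum_smul]
        rw [Finset.sum_mul]
        refine Finset.sum_congr rfl fun i _ => ?_
        rw [Finset.sum_mul, Finset.sum_comm]
        refine Finset.sum_congr rfl fun j _ => ?_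
        simp only [Finset.mul_sum, smul_mul_smul_comm, hmul]
        symm
        rw [Finset.sum_eq_single j]
        · simp
        · intro k _ hk
          simp [hk.symm]
        · simp
      map_star' := fun m => by
        simp only [star_sum, star_smul, hstar, Matrix.star_apply]
        rw [Finset.sum_comm] }
  exact NonUnitalStarAlgHom.norm_apply_le φ m

open scoped Matrix.Norms.L2Operator in
lemma Orthonormal.norm_compression_le {H : Type*} [NormedAddCommGroup H]
    [InnerProductSpace ℂ H] {e : ι → H} (he : Orthonormal ℂ e) (y : H →L[ℂ] H) :
    ‖(Matrix.of fun i j => inner ℂ (e i) (y (e j)) : Matrix ι ι ℂ)‖ ≤ ‖y‖ := by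
  rw [Matrix.l2_opNorm_def]
  refine ContinuousLinearMap.opNorm_le_bound _ (norm_nonneg y) fun v => ?_
  have h1 : ∀ i, (Matrix.toEuclideanLin (Matrix.of fun i j => inner ℂ (e i) (y (e j))) v) i =
      inner ℂ (e i) (y (∑ j, v j • e j)) := fun i => by
    simp [Matrix.toLpLin_apply, Matrix.mulVec, dotProduct, mul_comm]
  have h2 : ‖∑ j, v j • e j‖ = ‖v‖ := by
    rw [← sq_eq_sq₀ (norm_nonneg _) (norm_nonneg _), EuclideanSpace.norm_sq_eq]
    have := he.inner_sum (fun i => v i) (fun i => v i) Finset.univ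
    rw [inner_self_eq_norm_sq_to_K] at this
    simp only [RCLike.conj_mul] at this
    exact_mod_cast this
  have h3 : ‖Matrix.toEuclideanLin (Matrix.of fun i j => inner ℂ (e i) (y (e j))) v‖ ^ 2 ≤
      ‖y (∑ j, v j • e j)‖ ^ 2 := by
    rw [EuclideanSpace.norm_sq_eq]
    simp only [h1]
    exact he.sum_inner_products_le _
  refine (pow_le_pow_iff_left₀ (norm_nonneg _) (norm_nonneg _) two_ne_zero).mp h3 |>.trans ?_
  rw [← h2]
  exact y.le_opNorm _

end MatrixUnits

section Family

variable {n : ℕ} {a : Fin n → Fin n → Bool}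

lemma IsCKFamily.ckRelations {H : Type*} [NormedAddCommGroup H] [InnerProductSpace ℂ H]
    [CompleteSpace H] {s : Fin n → H →L[ℂ] H} (hs : IsCKFamily a s) : CKRelations a s where
  orth := by
    intro i j hij
    obtain ⟨hp, hsum, -⟩ := hs
    set P : Fin n → H →L[ℂ] H := fun k => s k * star (s k) with hP
    have hPstar : ∀ k, star (P k) = P k := fun k => by simp [hP]
    have hPs : ∀ k, P k * s k = s k := hp
    have hsum' : ∑ k, P k = 1 := hsum
    have hPP : P j * P j = P j := by
      conv_lhs => rw [hP]
      exact (mul_assoc _ _ _).symm.trans (congrArg (· * star (s j)) (hPs j))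
    have h1 : ∑ k, P j * P k * P j = P j := by
      rw [← Finset.sum_mul, ← Finset.mul_sum, hsum', mul_one, hPP]
    have h2 : ∑ k ∈ Finset.univ.erase j, star (star (s k) * P j) * (star (s k) * P j) = 0 := by
      rw [← Finset.add_sum_erase _ _ (Finset.mem_univ j), hPP, hPP] at h1
      have := add_eq_left.mp h1
      rw [← this]
      refine Finset.sum_congr rfl fun k _ => ?_
      simp [hP, mul_assoc]
    rw [Finset.sum_eq_zero_iff_of_nonneg (fun k _ => star_mul_self_nonneg _)] at h2
    have h3 := CStarRing.star_mul_self_eq_zero_iff _ |>.mp (h2 i (by simp [hij]))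
    rw [← hPs j, ← mul_assoc, h3, zero_mul]
  sum_range := hs.2.1
  source := fun i => (hs.2.2 i).symm

lemma CKRelations.prod {R R' : Type*} [Ring R] [StarRing R] [Ring R'] [StarRing R']
    {s : Fin n → R} {s' : Fin n → R'} (hs : CKRelations a s) (hs' : CKRelations a s') :
    CKRelations a (fun i => (s i, s' i)) where
  orth i j hij := Prod.ext (hs.orth i j hij) (hs'.orth i j hij)
  sum_range := by
    refine Prod.ext ?_ ?_
    · simpa [Prod.fst_sum] using hs.sum_range
    · simpa [Prod.snd_sum] using hs'.sum_range
  source i := by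
    refine Prod.ext ?_ ?_
    · simp only [Prod.fst_sum, apply_ite Prod.fst]
      exact hs.source i
    · simp only [Prod.snd_sum, apply_ite Prod.snd]
      exact hs'.source i

lemma wordProd_prod {R R' : Type*} [Ring R] [Ring R'] (s : Fin n → R) (s' : Fin n → R')
    (l : List (Fin n)) :
    wordProd (fun i => (s i, s' i)) l = (wordProd s l, wordProd s' l) := by
  induction l with
  | nil => simp only [wordProd_nil]; rfl
  | cons i l ih => simp [ih]

variable {H : Type*} [NormedAddCommGroup H] [InnerProductSpace ℂ H] [CompleteSpace H]
  {s : Fin n → H →L[ℂ] H}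

lemma inner_star_mul_apply (x y : H →L[ℂ] H) (ξ ζ : H) :
    inner ℂ ξ ((star x * y) ζ) = inner ℂ (x ξ) (y ζ) := by
  rw [mul_apply_eq_comp, ContinuousLinearMap.star_eq_adjoint,
    ContinuousLinearMap.adjoint_inner_right]

/-- A unit vector in the range of `s j` whose images under words of different lengths at most `M`
are orthogonal. -/
lemma CKRelations.exists_separating_vector (hs : CKRelations a s) (hs0 : ∀ i, s i ≠ 0)
    (hA : ∀ i, ∃ j, a i j = true)
    (hNT : ¬ ∃ γ : List (Fin n), IsCircuit a γ ∧ IsTerminal a γ) (j : Fin n) (M : ℕ) :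
    ∃ ζ : H, ‖s j ζ‖ = 1 ∧ ∀ σ τ : List (Fin n), σ.length ≤ M → τ.length ≤ M →
      σ.length ≠ τ.length →
      inner ℂ (wordProd s σ (s j ζ)) (wordProd s τ (s j ζ)) = 0 := by
  obtain ⟨l, hadm, hl⟩ := exists_aperiodic_word hA hNT j M
  obtain ⟨ξ, hξ⟩ : ∃ ξ, wordProd s (j :: l) ξ ≠ 0 := by
    by_contra! hcon
    exact hs.wordProd_ne_zero hs0 hadm (ContinuousLinearMap.ext hcon)
  set ξ' := ((‖wordProd s (j :: l) ξ‖⁻¹ : ℝ) : ℂ) • ξ with hξ'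
  have hw : s j (wordProd s l ξ') = wordProd s (j :: l) ξ' := by
    rw [wordProd_cons, mul_apply_eq_comp]
  have hlt : ∀ σ τ : List (Fin n), σ.length < τ.length → τ.length ≤ M →
      inner ℂ (wordProd s σ (wordProd s (j :: l) ξ'))
        (wordProd s τ (wordProd s (j :: l) ξ')) = 0 := by
    intro σ τ hlt hτ
    have := hs.star_wordProd_mul_wordProd_append_eq_zero hl hlt hτ
    rw [← mul_apply_eq_comp, ← mul_apply_eq_comp, ← wordProd_append,
      ← wordProd_append, ← inner_star_mul_apply, this]
    simp
  refine ⟨wordProd s l ξ', ?_, fun σ τ hσ hτ hne => ?_⟩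
  · rw [hw, hξ', map_smul, norm_smul]
    rw [Complex.norm_real, norm_inv, norm_norm, inv_mul_cancel₀ (norm_ne_zero_iff.mpr hξ)]
  · rw [hw]
    rcases lt_or_gt_of_ne hne with h | h
    · exact hlt σ τ h hτ
    · rw [← inner_conj_symm, hlt τ σ h hσ, map_zero]

end Family

section Core

variable {n : ℕ} {a : Fin n → Fin n → Bool}
  {H H' : Type*} [NormedAddCommGroup H] [InnerProductSpace ℂ H] [CompleteSpace H]
  [NormedAddCommGroup H'] [InnerProductSpace ℂ H'] [CompleteSpace H']
  {s : Fin n → H →L[ℂ] H} {s' : Fin n → H' →L[ℂ] H'}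

/-- The words of length `M` that stay admissible when `j` is appended. -/
abbrev WordsTo (a : Fin n → Fin n → Bool) (M : ℕ) (j : Fin n) : Type :=
  {α : List.Vector (Fin n) M // AdmissibleWord a (α.toList ++ [j])}

open Classical in
noncomputable instance (M : ℕ) (j : Fin n) : Fintype (WordsTo a M j) :=
  inferInstanceAs (Fintype {α : List.Vector (Fin n) M // AdmissibleWord a (α.toList ++ [j])})

lemma WordsTo.ext_toList {M : ℕ} {j : Fin n} {α β : WordsTo a M j}
    (h : α.1.toList = β.1.toList) : α = β := Subtype.ext (List.Vector.eq _ _ h)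

lemma CKRelations.star_wordProd_mul_wordProd_apply (hs : CKRelations a s) {M : ℕ} {j : Fin n}
    {μ : List (Fin n)} (hμ : μ.length = M) (α : WordsTo a M j) (ζ : H) :
    (star (wordProd s μ) * wordProd s α.1.toList) (s j ζ) =
      if μ = α.1.toList then s j ζ else 0 := by
  split_ifs with h
  · rw [h, ← mul_apply_eq_comp, hs.star_wordProd_mul_self_mul, if_pos α.2]
  · rw [hs.star_wordProd_mul_eq_zero (by simp [hμ]) h]
    rfl

open Classical in
lemma CKRelations.orthonormal_wordProd (hs : CKRelations a s) (M : ℕ) {j : Fin n} {ζ : H}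
    (hζ : ‖s j ζ‖ = 1) :
    Orthonormal ℂ fun α : WordsTo a M j => wordProd s α.1.toList (s j ζ) := by
  rw [orthonormal_iff_ite]
  intro α β
  rw [← inner_star_mul_apply, hs.star_wordProd_mul_wordProd_apply (by simp)]
  by_cases h : α = β
  · subst h
    simp [inner_self_eq_norm_sq_to_K, hζ]
  · rw [if_neg h, if_neg fun h' => h (WordsTo.ext_toList h'), inner_zero_right]

/-- The matrix coefficients of an operator with respect to the vectors `s_α s_j ζ`. -/
noncomputable def coeffMatrix (s : Fin n → H →L[ℂ] H) (a : Fin n → Fin n → Bool) (M : ℕ)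
    (j : Fin n) (ζ : H) (y : H →L[ℂ] H) : Matrix (WordsTo a M j) (WordsTo a M j) ℂ :=
  Matrix.of fun α β =>
    inner ℂ (wordProd s α.1.toList (s j ζ)) (y (wordProd s β.1.toList (s j ζ)))

omit [CompleteSpace H] in
lemma coeffMatrix_add (M : ℕ) (j : Fin n) (ζ : H) (y z : H →L[ℂ] H) :
    coeffMatrix s a M j ζ (y + z) = coeffMatrix s a M j ζ y + coeffMatrix s a M j ζ z := by
  ext α β
  simp [coeffMatrix]

omit [CompleteSpace H] in
lemma coeffMatrix_smul (M : ℕ) (j : Fin n) (ζ : H) (c : ℂ) (y : H →L[ℂ] H) :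
    coeffMatrix s a M j ζ (c • y) = c • coeffMatrix s a M j ζ y := by
  ext α β
  simp [coeffMatrix]

lemma coeffMatrix_wordProd_mul_star (M : ℕ) (j : Fin n) (ζ : H) (μ ν : List (Fin n))
    (α β : WordsTo a M j) :
    coeffMatrix s a M j ζ (wordProd s μ * star (wordProd s ν)) α β =
      inner ℂ ((star (wordProd s μ) * wordProd s α.1.toList) (s j ζ))
        ((star (wordProd s ν) * wordProd s β.1.toList) (s j ζ)) := by
  have : ∀ x y : H →L[ℂ] H, ∀ ξ η : H,
      inner ℂ ξ ((x * star y) η) = inner ℂ ((star x) ξ) ((star y) η) := fun x y ξ η => by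
    rw [← inner_star_mul_apply, star_star]
  simp only [coeffMatrix, Matrix.of_apply]
  rw [this]
  simp only [mul_apply_eq_comp]

lemma CKRelations.coeffMatrix_offDiag_eq_zero (hs : CKRelations a s) {M : ℕ} {j : Fin n} {ζ : H}
    (hζ : ∀ σ τ : List (Fin n), σ.length ≤ M → τ.length ≤ M → σ.length ≠ τ.length →
      inner ℂ (wordProd s σ (s j ζ)) (wordProd s τ (s j ζ)) = 0)
    {w : (H →L[ℂ] H) × (H' →L[ℂ] H')}
    (hw : w ∈ offDiagSpan (fun i => (s i, s' i)) M) :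
    coeffMatrix s a M j ζ w.1 = 0 := by
  induction hw using Submodule.span_induction with
  | mem w hw =>
    obtain ⟨μ, ν, hμ, hν, hne, rfl⟩ := hw
    ext α β
    simp only [wordProd_prod, Prod.fst_mul, Prod.fst_star]
    rw [coeffMatrix_wordProd_mul_star, ← mul_apply_eq_comp, ← mul_apply_eq_comp]
    rcases hs.star_wordProd_mul_wordProd_mul (ν := μ) (β := α.1.toList) (by simpa) j with
      h | ⟨σ, hσ, h⟩
    · simp [h]
    rcases hs.star_wordProd_mul_wordProd_mul (ν := ν) (β := β.1.toList) (by simpa) j with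
      h' | ⟨τ, hτ, h'⟩
    · simp [h']
    rw [h, h', mul_apply_eq_comp, mul_apply_eq_comp]
    simp only [List.Vector.toList_length] at hσ hτ
    exact hζ σ τ (by omega) (by omega) (by omega)
  | zero => ext; simp [coeffMatrix]
  | add x y _ _ hx hy => rw [Prod.fst_add, coeffMatrix_add, hx, hy, add_zero]
  | smul c x _ hx => rw [Prod.smul_fst, coeffMatrix_smul, hx, smul_zero]

open Classical in
lemma CKRelations.sum_wordsTo (hs : CKRelations a s') {M : ℕ} (j : Fin n) {μ : List (Fin n)}
    (hμ : μ.length = M) :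
    ∑ α : WordsTo a M j, (if μ = α.1.toList then wordProd s' (α.1.toList ++ [j]) else 0) =
      wordProd s' (μ ++ [j]) := by
  by_cases hadm : AdmissibleWord a (μ ++ [j])
  · rw [Finset.sum_eq_single ⟨⟨μ, hμ⟩, hadm⟩]
    · simp [List.Vector.toList]
    · intro α _ hα
      rw [if_neg]
      intro h
      exact hα (WordsTo.ext_toList h.symm)
    · simp
  · rw [hs.wordProd_eq_zero hadm]
    refine Finset.sum_eq_zero fun α _ => ?_
    rw [if_neg]
    rintro rfl
    exact hadm α.2

lemma CKRelations.snd_eq_sum_coeffMatrix (hs : CKRelations a s) (hs' : CKRelations a s') {M : ℕ}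
    {ζ : Fin n → H} (hζ : ∀ j, ‖s j (ζ j)‖ = 1) {z : (H →L[ℂ] H) × (H' →L[ℂ] H')}
    (hz : z ∈ homogSpan (fun i => (s i, s' i)) M M) :
    z.2 = ∑ j, ∑ α : WordsTo a M j, ∑ β : WordsTo a M j, coeffMatrix s a M j (ζ j) z.1 α β •
      (wordProd s' (α.1.toList ++ [j]) * star (wordProd s' (β.1.toList ++ [j]))) := by
  classical
  induction hz using Submodule.span_induction with
  | mem z hz =>
    obtain ⟨μ, ν, hμ, hν, rfl⟩ := hz
    simp only [wordProd_prod, Prod.fst_mul, Prod.fst_star, Prod.snd_mul, Prod.snd_star]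
    rw [hs'.wordProd_mul_star]
    refine Finset.sum_congr rfl fun j _ => ?_
    rw [← hs'.sum_wordsTo j hμ, ← hs'.sum_wordsTo j hν, star_sum, Finset.sum_mul_sum]
    refine Finset.sum_congr rfl fun α _ => Finset.sum_congr rfl fun β _ => ?_
    rw [coeffMatrix_wordProd_mul_star, hs.star_wordProd_mul_wordProd_apply hμ,
      hs.star_wordProd_mul_wordProd_apply hν]
    split_ifs <;> simp [inner_self_eq_norm_sq_to_K, hζ]
  | zero => simp [coeffMatrix]
  | add x y _ _ hx hy =>
    simp only [Prod.snd_add, Prod.fst_add, coeffMatrix_add, Matrix.add_apply, add_smul,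
      Finset.sum_add_distrib, ← hx, ← hy]
  | smul c x _ hx =>
    simp only [Prod.smul_snd, Prod.smul_fst, coeffMatrix_smul, Matrix.smul_apply, smul_assoc,
      ← Finset.smul_sum, ← hx]

/-- The diagonal part of an element, in the second representation, is controlled by the norm of
the whole element in the first one. -/
lemma CKRelations.norm_snd_le_of_offDiag (hs : CKRelations a s) (hs0 : ∀ i, s i ≠ 0)
    (hs' : CKRelations a s') (hA : ∀ i, ∃ j, a i j = true)
    (hNT : ¬ ∃ γ : List (Fin n), IsCircuit a γ ∧ IsTerminal a γ) {M : ℕ}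
    {z w : (H →L[ℂ] H) × (H' →L[ℂ] H')}
    (hz : z ∈ homogSpan (fun i => (s i, s' i)) M M)
    (hw : w ∈ offDiagSpan (fun i => (s i, s' i)) M) :
    ‖z.2‖ ≤ n * ‖(z + w).1‖ := by
  classical
  choose ζ hζ hζ' using fun j => hs.exists_separating_vector hs0 hA hNT j M
  rw [hs.snd_eq_sum_coeffMatrix hs' hζ hz]
  refine (norm_sum_le_of_le (n := fun _ => ‖(z + w).1‖) _ fun j _ => ?_).trans (by simp)
  have hzw : coeffMatrix s a M j (ζ j) z.1 = coeffMatrix s a M j (ζ j) (z + w).1 := by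
    rw [Prod.fst_add, coeffMatrix_add, hs.coeffMatrix_offDiag_eq_zero (hζ' j) hw, add_zero]
  rw [hzw]
  refine (norm_sum_smul_matrixUnits_le (fun α β : WordsTo a M j =>
    wordProd s' (α.1.toList ++ [j]) * star (wordProd s' (β.1.toList ++ [j]))) ?_ ?_ _).trans
      ((hs.orthonormal_wordProd M (hζ j)).norm_compression_le (z + w).1)
  · intro α β γ δ
    have e : ∀ x y z w : H' →L[ℂ] H', x * star y * (z * star w) = x * (star y * z) * star w :=
      fun x y z w => by simp only [mul_assoc]
    rw [e]
    split_ifs with h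
    · subst h
      have h1 : star (wordProd s' (β.1.toList ++ [j])) * wordProd s' (β.1.toList ++ [j]) =
          star (s' j) * s' j := by
        have := hs'.star_wordProd_mul_self_mul β.1.toList j
        rw [if_pos β.2] at this
        simp only [wordProd_append, star_mul, mul_assoc] at this ⊢
        simp [this]
      have h2 : wordProd s' (α.1.toList ++ [j]) * (star (s' j) * s' j) =
          wordProd s' (α.1.toList ++ [j]) := by
        have := hs'.range_mul j
        rw [mul_assoc] at this
        simp [wordProd_append, mul_assoc, this]
      rw [h1, h2]
    · rw [hs'.star_wordProd_mul_eq_zero (by simp), mul_zero, zero_mul]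
      exact fun h' => h (WordsTo.ext_toList (List.append_cancel_right h'))
  · intro α β
    simp

end Core

section Norm

variable {n : ℕ} {a : Fin n → Fin n → Bool}
  {H H' : Type*} [NormedAddCommGroup H] [InnerProductSpace ℂ H] [CompleteSpace H]
  [NormedAddCommGroup H'] [InnerProductSpace ℂ H'] [CompleteSpace H']
  {s : Fin n → H →L[ℂ] H} {s' : Fin n → H' →L[ℂ] H'}

lemma CKRelations.norm_snd_sq_le_of_mem_filtSpan (hs : CKRelations a s) (hs0 : ∀ i, s i ≠ 0)
    (hs' : CKRelations a s') (hA : ∀ i, ∃ j, a i j = true)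
    (hNT : ¬ ∃ γ : List (Fin n), IsCircuit a γ ∧ IsTerminal a γ) {K N : ℕ}
    {x : (H →L[ℂ] H) × (H' →L[ℂ] H')} (hx : x ∈ filtSpan (fun i => (s i, s' i)) K N) :
    ‖x.2‖ ^ 2 ≤ (K : ℝ) ^ 2 * n * ‖x.1‖ ^ 2 := by
  have ht := hs.prod hs'
  obtain ⟨y, hy, rfl⟩ := mem_filtSpan_iff.mp hx
  set x := ∑ k ∈ Finset.range K, y k with hxdef
  set z := ∑ k ∈ Finset.range K, star (y k) * y k with hz
  set w := ∑ k ∈ Finset.range K, ∑ l ∈ (Finset.range K).erase k, star (y k) * y l with hw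
  have hzw : z + w = star x * x := by
    rw [hxdef, star_sum, Finset.sum_mul_sum, hz, hw, ← Finset.sum_add_distrib]
    exact Finset.sum_congr rfl fun k hk => Finset.add_sum_erase _ (fun l => star (y k) * y l) hk
  have hzmem : z ∈ homogSpan (fun i => (s i, s' i)) (N + 1 + K) (N + 1 + K) :=
    sum_mem fun k _ => ht.homogSpan_le_add _ _ K
      (ht.mul_mem_homogSpan_of_eq (star_mem_homogSpan (hy k)) (hy k))
  have hwmem : w ∈ offDiagSpan (fun i => (s i, s' i)) (N + 1 + K) := by
    refine sum_mem fun k hk => sum_mem fun l hl => ?_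
    rw [Finset.mem_erase, Finset.mem_range] at hl
    rw [Finset.mem_range] at hk
    exact homogSpan_le_offDiagSpan _ (by omega) (by omega) (by omega)
      (ht.mul_mem_homogSpan (star_mem_homogSpan (hy k)) (hy l))
  have hle : ‖z.2‖ ≤ n * ‖x.1‖ ^ 2 := by
    have := hs.norm_snd_le_of_offDiag hs0 hs' hA hNT hzmem hwmem
    rwa [hzw, Prod.fst_mul, Prod.fst_star, CStarRing.norm_star_mul_self, ← sq] at this
  have hk : ∀ k ∈ Finset.range K, ‖(y k).2‖ ^ 2 ≤ n * ‖x.1‖ ^ 2 := fun k hk => by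
    refine le_trans ?_ hle
    rw [sq, ← CStarRing.norm_star_mul_self]
    have hz2 : z.2 = ∑ k ∈ Finset.range K, star (y k).2 * (y k).2 := by
      simp [hz, Prod.snd_sum]
    rw [hz2]
    exact CStarAlgebra.norm_le_norm_of_nonneg_of_le (star_mul_self_nonneg _)
      (Finset.single_le_sum (f := fun k => star (y k).2 * (y k).2)
        (fun _ _ => star_mul_self_nonneg _) hk)
  have hx2 : x.2 = ∑ k ∈ Finset.range K, (y k).2 := by simp [hxdef, Prod.snd_sum]
  calc ‖x.2‖ ^ 2 ≤ (∑ k ∈ Finset.range K, ‖(y k).2‖) ^ 2 := by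
        rw [hx2]; gcongr; exact norm_sum_le _ _
    _ ≤ (Finset.range K).card * ∑ k ∈ Finset.range K, ‖(y k).2‖ ^ 2 := sq_sum_le_card_mul_sum_sq
    _ ≤ (Finset.range K).card * ∑ k ∈ Finset.range K, n * ‖x.1‖ ^ 2 := by
        gcongr with k hk'; exact hk k hk'
    _ = (K : ℝ) ^ 2 * n * ‖x.1‖ ^ 2 := by simp; ring

lemma le_of_forall_pow_two_pow_le {b c C : ℝ} (hc : 0 ≤ c)
    (h : ∀ r : ℕ, (b ^ 2 ^ r) ^ 2 ≤ C * ((2 : ℝ) ^ r) ^ 2 * (c ^ 2 ^ r) ^ 2) : b ≤ c := by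
  by_contra! hcb
  have hb : 0 < b := hc.trans_lt hcb
  have hlim : Filter.Tendsto
      (fun r : ℕ => C * (((2 ^ r : ℕ) : ℝ) * (c / b) ^ 2 ^ r) ^ 2) Filter.atTop (nhds (C * 0 ^ 2)) :=
    (((tendsto_self_mul_const_pow_of_lt_one (div_nonneg hc hb.le)
      ((div_lt_one hb).mpr hcb)).comp (tendsto_pow_atTop_atTop_of_one_lt one_lt_two)).pow
        2).const_mul C
  have : (1 : ℝ) ≤ C * 0 ^ 2 := by
    refine ge_of_tendsto' hlim fun r => ?_
    have hpos : 0 < (b ^ 2 ^ r) ^ 2 := by positivity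
    have e : C * (((2 ^ r : ℕ) : ℝ) * (c / b) ^ 2 ^ r) ^ 2 =
        C * ((2 : ℝ) ^ r) ^ 2 * (c ^ 2 ^ r) ^ 2 / (b ^ 2 ^ r) ^ 2 := by
      rw [div_pow]; push_cast; field_simp
    rw [e, le_div_iff₀ hpos, one_mul]
    exact h r
  norm_num at this

lemma norm_star_mul_self_pow_two_pow {E : Type*} [CStarAlgebra E] (y : E) (r : ℕ) :
    ‖(star y * y) ^ 2 ^ r‖ = (‖y‖ ^ 2) ^ 2 ^ r := by
  rw [sq, ← CStarRing.norm_star_mul_self]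
  exact congrArg NNReal.toReal ((IsSelfAdjoint.star_mul_self y).nnnorm_pow_two_pow r)

lemma CKRelations.norm_snd_le_norm_fst (hs : CKRelations a s) (hs0 : ∀ i, s i ≠ 0)
    (hs' : CKRelations a s') (hA : ∀ i, ∃ j, a i j = true)
    (hNT : ¬ ∃ γ : List (Fin n), IsCircuit a γ ∧ IsTerminal a γ)
    {x : (H →L[ℂ] H) × (H' →L[ℂ] H')}
    (hx : x ∈ StarAlgebra.adjoin ℂ (Set.range fun i => (s i, s' i))) : ‖x.2‖ ≤ ‖x.1‖ := by
  have ht := hs.prod hs'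
  obtain ⟨K, N, hK⟩ := ht.exists_mem_filtSpan (mul_mem (star_mem hx) hx)
  have hsq : ‖x.2‖ ^ 2 ≤ ‖x.1‖ ^ 2 := by
    refine le_of_forall_pow_two_pow_le (C := (K : ℝ) ^ 2 * n) (by positivity) fun r => ?_
    obtain ⟨m, hm⟩ : ∃ m, 2 ^ r = m + 1 := ⟨2 ^ r - 1, (Nat.succ_pred (by positivity)).symm⟩
    obtain ⟨N', hN'⟩ := ht.pow_mem_filtSpan hK m
    rw [← hm] at hN'
    have := hs.norm_snd_sq_le_of_mem_filtSpan hs0 hs' hA hNT hN'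
    simp only [Prod.pow_fst, Prod.pow_snd, Prod.fst_mul, Prod.snd_mul, Prod.fst_star,
      Prod.snd_star, norm_star_mul_self_pow_two_pow] at this
    refine this.trans_eq ?_
    push_cast
    ring
  exact (pow_le_pow_iff_left₀ (norm_nonneg _) (norm_nonneg _) two_ne_zero).mp hsq

end Norm

section Closure

variable {A B : Type*} [CStarAlgebra A] [CStarAlgebra B]

/-- A star homomorphism that is isometric on the star algebra generated by a set identifies the
C⋆-algebras generated by the set and by its image. -/
lemma StarAlgHom.exists_starAlgEquiv_topologicalClosure_adjoin {ι : Type*} (p : A →⋆ₐ[ℂ] B)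
    (hp : Continuous p) (t : ι → A) (u : ι → B) (htu : ∀ i, p (t i) = u i)
    (h : ∀ x ∈ StarAlgebra.adjoin ℂ (Set.range t), ‖p x‖ = ‖x‖) :
    ∃ φ : (StarAlgebra.adjoin ℂ (Set.range t)).topologicalClosure ≃⋆ₐ[ℂ]
        (StarAlgebra.adjoin ℂ (Set.range u)).topologicalClosure,
      Isometry φ ∧ ∀ x, (φ x : B) = p x := by
  set S := StarAlgebra.adjoin ℂ (Set.range t) with hS
  set T := StarAlgebra.adjoin ℂ (Set.range u) with hT
  have hST : S.map p = T := by
    rw [hS, hT, StarAlgHom.map_adjoin, ← Set.range_comp]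
    congr 2
    exact funext htu
  have hmem : ∀ x : S.topologicalClosure, p x ∈ T.topologicalClosure := fun x => by
    refine map_mem_closure hp x.2 fun y hy => ?_
    rw [← hST]
    exact ⟨y, hy, rfl⟩
  have hnorm : ∀ x ∈ S.topologicalClosure, ‖p x‖ = ‖x‖ := fun x hx =>
    closure_minimal (t := {x | ‖p x‖ = ‖x‖}) h (isClosed_eq hp.norm continuous_norm) hx
  let f : S.topologicalClosure →⋆ₐ[ℂ] T.topologicalClosure :=
    (p.comp S.topologicalClosure.subtype).codRestrict _ hmem
  have hf : ∀ x, (f x : B) = p x := fun _ => rfl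
  have hiso : Isometry f := AddMonoidHomClass.isometry_of_norm f fun x => hnorm x x.2
  have hclosed : IsClosed (p '' (S.topologicalClosure : Set A)) := by
    have hc : IsClosed (Set.range fun x : S.topologicalClosure => p x) := by
      have : CompleteSpace S.topologicalClosure :=
        S.isClosed_topologicalClosure.completeSpace_coe
      have hi : Isometry (p.comp S.topologicalClosure.subtype) :=
        AddMonoidHomClass.isometry_of_norm _ fun x => hnorm x x.2
      exact hi.isClosedEmbedding.isClosed_range
    rwa [Set.image_eq_range]
  have hsurj : Function.Surjective f := fun y => by
    have : (y : B) ∈ p '' (S.topologicalClosure : Set A) := by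
      refine closure_minimal ?_ hclosed y.2
      rw [← hST]
      rintro _ ⟨x, hx, rfl⟩
      exact ⟨x, S.le_topologicalClosure hx, rfl⟩
    obtain ⟨x, hx, hxy⟩ := this
    exact ⟨⟨x, hx⟩, Subtype.ext hxy⟩
  exact ⟨StarAlgEquiv.ofBijective f ⟨hiso.injective, hsurj⟩, hiso, hf⟩

end Closure

/-- Cuntz–Krieger uniqueness: suppose `A` has no terminal circuits, and
let `(s_i)` and `(s_i')` be Cuntz–Krieger `A`-families of nonzero partial isometries on
complex Hilbert spaces `H` and `H'`.  Then there is an isometric ⋆-isomorphism from the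
C*-algebra generated by the `s_i` in `B(H)` onto the C*-algebra generated by the `s_i'`
in `B(H')` carrying `s_i` to `s_i'`. -/
theorem stmt_18 {H H' : Type*}
    [NormedAddCommGroup H] [InnerProductSpace ℂ H] [CompleteSpace H]
    [NormedAddCommGroup H'] [InnerProductSpace ℂ H'] [CompleteSpace H']
    (n : ℕ) (hn : 1 ≤ n) (a : Fin n → Fin n → Bool)
    (hA : ∀ i, ∃ j, a i j = true)
    (hNT : ¬ ∃ γ : List (Fin n), IsCircuit a γ ∧ IsTerminal a γ)
    (s : Fin n → H →L[ℂ] H) (hs : IsCKFamily a s) (hs0 : ∀ i, s i ≠ 0)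
    (s' : Fin n → H' →L[ℂ] H') (hs' : IsCKFamily a s') (hs'0 : ∀ i, s' i ≠ 0) :
    ∃ φ : (StarAlgebra.adjoin ℂ (Set.range s)).topologicalClosure ≃⋆ₐ[ℂ]
        (StarAlgebra.adjoin ℂ (Set.range s')).topologicalClosure,
      Isometry φ ∧
      ∀ i, (φ ⟨s i, (StarAlgebra.adjoin ℂ (Set.range s)).le_topologicalClosure
              (StarAlgebra.subset_adjoin ℂ _ ⟨i, rfl⟩)⟩ : H' →L[ℂ] H') = s' i := by
  have h := hs.ckRelations
  have h' := hs'.ckRelations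
  let t : Fin n → (H →L[ℂ] H) × (H' →L[ℂ] H') := fun i => (s i, s' i)
  have hle : ∀ x ∈ StarAlgebra.adjoin ℂ (Set.range t), ‖x.2‖ ≤ ‖x.1‖ := fun x hx =>
    h.norm_snd_le_norm_fst hs0 h' hA hNT hx
  have hge : ∀ x ∈ StarAlgebra.adjoin ℂ (Set.range t), ‖x.1‖ ≤ ‖x.2‖ := fun x hx => by
    let swap : (H →L[ℂ] H) × (H' →L[ℂ] H') →⋆ₐ[ℂ] (H' →L[ℂ] H') × (H →L[ℂ] H) :=
      (StarAlgHom.snd ℂ _ _).prod (StarAlgHom.fst ℂ _ _)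
    refine h'.norm_snd_le_norm_fst (x := swap x) hs'0 h hA hNT ?_
    have : swap x ∈ (StarAlgebra.adjoin ℂ (Set.range t)).map swap := ⟨x, hx, rfl⟩
    rwa [StarAlgHom.map_adjoin, ← Set.range_comp] at this
  obtain ⟨φ, hφ, hφp⟩ := (StarAlgHom.fst ℂ (H →L[ℂ] H)
    (H' →L[ℂ] H')).exists_starAlgEquiv_topologicalClosure_adjoin continuous_fst t s
      (fun _ => rfl) fun x hx => (max_eq_left (hle x hx)).symm
  obtain ⟨ψ, hψ, hψp⟩ := (StarAlgHom.snd ℂ (H →L[ℂ] H)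
    (H' →L[ℂ] H')).exists_starAlgEquiv_topologicalClosure_adjoin continuous_snd t s'
      (fun _ => rfl) fun x hx => (max_eq_right (hge x hx)).symm
  refine ⟨φ.symm.trans ψ, ?_, fun i => ?_⟩
  · exact hψ.comp (hφ.right_inv φ.apply_symm_apply)
  · let ti : (StarAlgebra.adjoin ℂ (Set.range t)).topologicalClosure :=
      ⟨t i, (StarAlgebra.adjoin ℂ (Set.range t)).le_topologicalClosure
        (StarAlgebra.subset_adjoin ℂ _ ⟨i, rfl⟩)⟩
    have hti : φ ti = ⟨s i, (StarAlgebra.adjoin ℂ (Set.range s)).le_topologicalClosure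
        (StarAlgebra.subset_adjoin ℂ _ ⟨i, rfl⟩)⟩ := Subtype.ext (hφp ti)
    rw [← hti, StarAlgEquiv.trans_apply, StarAlgEquiv.symm_apply_apply]
    exact hψp ti
end
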